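/- Let k ≥ 2 and n ≥ 1 be integers, and let X be a set of kn points in general position in ℝ² partitioned into two color classes A and B, each containing at least n points. Then X spans n pairwise disjoint 2-colorful k-islands; that is, there exist subsets Y₁, …, Yₙ of X such that each Yᵢ has exactly k points, each Yᵢ contains at least one point of A and at least one point of B, X ∩ conv(Yᵢ) = Yᵢ for every i, and the convex hulls conv(Y₁), …, conv(Yₙ) are pairwise disjoint. -/

import Mathlib

/-- A finite point set in `ℝ^d` is in general position if every subset
of size at most `d + 1` is affinely independent. -/
noncomputable instance : DecidableEq (EuclideanSpace ℝ (Fin 2)) := Classical.decEq _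

def GenPos (d : ℕ) (X : Finset (EuclideanSpace ℝ (Fin d))) : Prop :=
  ∀ S : Finset (EuclideanSpace ℝ (Fin d)), S ⊆ X → S.card ≤ d + 1 →
    AffineIndependent ℝ (fun p : S => (p : EuclideanSpace ℝ (Fin d)))

namespace NEP

set_option linter.unusedSectionVars false

variable {V : Type*} [AddCommGroup V] [Module ℝ V] [DecidableEq V]

/-- no three points on a line, in terms of two coordinate functionals -/
def GP (x y : V →ₗ[ℝ] ℝ) (X : Finset V) : Prop :=
  ∀ a ∈ X, ∀ b ∈ X, ∀ c ∈ X, a ≠ b → a ≠ c → b ≠ c → ∀ α β γ : ℝ, (α ≠ 0 ∨ β ≠ 0) →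
    α * x a + β * y a = γ → α * x b + β * y b = γ → α * x c + β * y c = γ → False

lemma GP.mono {x y : V →ₗ[ℝ] ℝ} {X X' : Finset V} (h : GP x y X) (hs : X' ⊆ X) : GP x y X' :=
  fun a ha b hb c hc => h a (hs ha) b (hs hb) c (hs hc)

/-- `Y` is cut off from `X` by a line (weakly). -/
def IsHalf (x y : V →ₗ[ℝ] ℝ) (X Y : Finset V) : Prop :=
  Y ⊆ X ∧ ∃ α β : ℝ, (α ≠ 0 ∨ β ≠ 0) ∧
    ∀ a ∈ Y, ∀ b ∈ X \ Y, α * x a + β * y a ≤ α * x b + β * y b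

lemma IsHalf.compl {x y : V →ₗ[ℝ] ℝ} {X Y : Finset V} (h : IsHalf x y X Y) :
    IsHalf x y X (X \ Y) := by
  obtain ⟨hs, α, β, h0, h⟩ := h
  refine ⟨Finset.sdiff_subset, -α, -β, by simpa using h0, ?_⟩
  intro a ha b hb
  rw [Finset.sdiff_sdiff_eq_self hs] at hb
  have := h b hb a ha
  linarith

lemma face (f : V →ₗ[ℝ] ℝ) (γ : ℝ) (Y : Finset V) (p : V)
    (hp : p ∈ convexHull ℝ (Y : Set V)) (hY : ∀ a ∈ Y, f a ≤ γ) (hpf : γ ≤ f p) :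
    ∃ a ∈ Y, f a = γ ∧ (p = a ∨ ∃ b ∈ Y, b ≠ a ∧ f b = γ) := by
  obtain ⟨w, hw0, hw1, hw⟩ := Finset.mem_convexHull'.1 hp
  have h1 : ∑ a ∈ Y, w a * (γ - f a) = γ - f p := by
    rw [← hw]
    simp only [map_sum, map_smul, smul_eq_mul, mul_sub, Finset.sum_sub_distrib, ← Finset.sum_mul, hw1]
    ring
  have h2 : ∀ a ∈ Y, 0 ≤ w a * (γ - f a) := fun a ha =>
    mul_nonneg (hw0 a ha) (by linarith [hY a ha])
  have h3 : ∑ a ∈ Y, w a * (γ - f a) = 0 := le_antisymm (by linarith) (Finset.sum_nonneg h2)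
  have h4 := (Finset.sum_eq_zero_iff_of_nonneg h2).1 h3
  have h5 : ∀ a ∈ Y, w a ≠ 0 → f a = γ := by
    intro a ha hwa
    have := h4 a ha
    rcases mul_eq_zero.1 this with h | h
    · exact absurd h hwa
    · linarith
  obtain ⟨a, ha, hwa⟩ : ∃ a ∈ Y, w a ≠ 0 := by
    by_contra! hcon
    rw [Finset.sum_eq_zero hcon] at hw1
    norm_num at hw1
  refine ⟨a, ha, h5 a ha hwa, ?_⟩
  by_cases hb : ∃ b ∈ Y, b ≠ a ∧ w b ≠ 0
  · obtain ⟨b, hb, hba, hwb⟩ := hb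
    exact Or.inr ⟨b, hb, hba, h5 b hb hwb⟩
  · push Not at hb
    left
    have e1 : ∑ b ∈ Y, w b = w a := Finset.sum_eq_single_of_mem a ha hb
    have e2 : ∑ b ∈ Y, w b • b = w a • a :=
      Finset.sum_eq_single_of_mem a ha (fun b hb' hba => by rw [hb b hb' hba, zero_smul])
    rw [← hw, e2, ← e1, hw1, one_smul]

lemma sep {x y : V →ₗ[ℝ] ℝ} {X Y Z : Finset V} (hX : GP x y X) (hY : Y ⊆ X) (hZ : Z ⊆ X)
    (hd : Disjoint Y Z) (α β γ : ℝ) (h0 : α ≠ 0 ∨ β ≠ 0)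
    (hYγ : ∀ a ∈ Y, α * x a + β * y a ≤ γ) (hZγ : ∀ a ∈ Z, γ ≤ α * x a + β * y a) :
    Disjoint (convexHull ℝ (Y : Set V)) (convexHull ℝ (Z : Set V)) := by
  rw [Set.disjoint_left]
  intro p hpY hpZ
  set f : V →ₗ[ℝ] ℝ := α • x + β • y with hf
  have hfa : ∀ a, f a = α * x a + β * y a := fun a => by simp [hf]
  have hle : f p ≤ γ := by
    have : (Y : Set V) ⊆ {q | f q ≤ γ} := fun a ha => by
      simp only [Set.mem_ofPred_eq, hfa]; exact hYγ a ha
    exact convexHull_min this (convex_halfSpace_le f.isLinear γ) hpY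
  have hge : γ ≤ f p := by
    have : (Z : Set V) ⊆ {q | γ ≤ f q} := fun a ha => by
      simp only [Set.mem_ofPred_eq, hfa]; exact hZγ a ha
    exact convexHull_min this (convex_halfSpace_ge f.isLinear γ) hpZ
  obtain ⟨a, ha, hfa1, h1⟩ := face f γ Y p hpY (fun a ha => by rw [hfa]; exact hYγ a ha) hge
  obtain ⟨b, hb, hfb1, h2⟩ := face (-f) (-γ) Z p hpZ
    (fun a ha => by simp only [LinearMap.neg_apply, hfa]; linarith [hZγ a ha])
    (by simp only [LinearMap.neg_apply]; linarith)
  have hne : ∀ c ∈ Y, ∀ d ∈ Z, c ≠ d := fun c hc d hd' h =>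
    Finset.disjoint_left.1 hd hc (h ▸ hd')
  have hfb : f b = γ := by simpa using hfb1
  rcases h1 with h1 | ⟨a', ha', haa, hfa'⟩
  · rcases h2 with h2 | ⟨b', hb', hbb, hfb'⟩
    · exact hne a ha b hb (h1 ▸ h2)
    · have hfb'' : f b' = γ := by simpa using hfb'
      exact hX a (hY ha) b (hZ hb) b' (hZ hb') (hne _ ha _ hb) (hne _ ha _ hb') hbb.symm α β γ h0
        (hfa a ▸ hfa1) (hfa b ▸ hfb) (hfa b' ▸ hfb'')
  · exact hX a (hY ha) a' (hY ha') b (hZ hb) haa.symm (hne _ ha _ hb) (hne _ ha' _ hb) α β γ h0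
        (hfa a ▸ hfa1) (hfa a' ▸ hfa') (hfa b ▸ hfb)

lemma IsHalf.disj {x y : V →ₗ[ℝ] ℝ} {X Y : Finset V} (hX : GP x y X) (h : IsHalf x y X Y) :
    Disjoint (convexHull ℝ (Y : Set V)) (convexHull ℝ ((X \ Y : Finset V) : Set V)) := by
  obtain ⟨hs, α, β, h0, h⟩ := h
  rcases Y.eq_empty_or_nonempty with rfl | hne
  · simp
  · obtain ⟨a, ha, hmax⟩ := Y.exists_max_image (fun a => α * x a + β * y a) hne
    exact sep hX hs Finset.sdiff_subset Finset.disjoint_sdiff α β _ h0 hmax (fun b hb => h a ha b hb)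

/-- low sets exist -/
lemma exists_low (S : Finset V) (f : V → ℝ) (j : ℕ) (hj : j ≤ S.card) :
    ∃ Y ⊆ S, Y.card = j ∧ ∀ a ∈ Y, ∀ b ∈ S \ Y, f a ≤ f b := by
  induction j with
  | zero => exact ⟨∅, by simp, by simp, by simp⟩
  | succ j ih =>
    obtain ⟨Y, hY, hc, hl⟩ := ih (by omega)
    have hne : (S \ Y).Nonempty := by
      rw [← Finset.card_pos, Finset.card_sdiff_of_subset hY]; omega
    obtain ⟨q, hq, hmin⟩ := (S \ Y).exists_min_image f hne
    rw [Finset.mem_sdiff] at hq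
    refine ⟨insert q Y, Finset.insert_subset hq.1 hY, by rw [Finset.card_insert_of_notMem hq.2, hc], ?_⟩
    intro a ha b hb
    have hb' : b ∈ S \ Y := by
      simp only [Finset.mem_sdiff, Finset.mem_insert, not_or] at hb ⊢; tauto
    rcases Finset.mem_insert.1 ha with rfl | ha
    · exact hmin b hb'
    · exact hl a ha b hb'

lemma low_tie (S R Y Y' : Finset V) (f : V → ℝ) (hY : Y ⊆ S) (hY' : Y' ⊆ S)
    (hf : ∀ a ∈ S, ∀ b ∈ S, ∀ c ∈ S, a ≠ b → a ≠ c → b ≠ c → f a = f b → f a = f c → False)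
    (hc : Y.card = Y'.card)
    (hl : ∀ a ∈ Y, ∀ b ∈ S \ Y, f a ≤ f b) (hl' : ∀ a ∈ Y', ∀ b ∈ S \ Y', f a ≤ f b) :
    (Y' ∩ R).card ≤ (Y ∩ R).card + 1 := by
  by_contra! hcon
  have h1 : (Y' ∩ R).card ≤ (Y ∩ R).card + (Y' \ Y).card := by
    refine (Finset.card_le_card (t := (Y ∩ R) ∪ (Y' \ Y)) ?_).trans (Finset.card_union_le _ _)
    intro a ha
    simp only [Finset.mem_inter, Finset.mem_union, Finset.mem_sdiff] at ha ⊢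
    tauto
  have h2 : 1 < (Y' \ Y).card := by omega
  have h3 : (Y' \ Y).card = (Y \ Y').card := by
    have := Finset.card_sdiff_add_card_inter Y Y'
    have := Finset.card_sdiff_add_card_inter Y' Y
    rw [Finset.inter_comm] at this
    omega
  obtain ⟨a, ha, b, hb, hab⟩ := Finset.one_lt_card.1 h2
  obtain ⟨c, hc⟩ := Finset.card_pos.1 (by omega : 0 < (Y \ Y').card)
  simp only [Finset.mem_sdiff] at ha hb hc
  have k1 : f a = f c := le_antisymm (hl' a ha.1 c (by simp [hc.2, hY hc.1]))
    (hl c hc.1 a (by simp [ha.2, hY' ha.1]))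
  have k2 : f b = f c := le_antisymm (hl' b hb.1 c (by simp [hc.2, hY hc.1]))
    (hl c hc.1 b (by simp [hb.2, hY' hb.1]))
  exact hf a (hY' ha.1) b (hY' hb.1) c (hY hc.1) hab (fun h => ha.2 (h ▸ hc.1))
    (fun h => hb.2 (h ▸ hc.1)) (k1.trans k2.symm) k1

/-- abstract intermediate value principle -/
lemma ivt {T ι : Type*} [TopologicalSpace T] [Finite ι] (S : Set T) (hS : IsPreconnected S)
    (W : ι → Set T) (hW : ∀ i, IsClosed (W i)) (σ : ι → Prop)
    (hcov : ∀ t ∈ S, ∃ i, t ∈ W i)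
    (hcons : ∀ t ∈ S, ∀ i j, t ∈ W i → t ∈ W j → σ i → σ j)
    (s t : T) (hs : s ∈ S) (ht : t ∈ S) (i j : ι) (hi : s ∈ W i) (hj : t ∈ W j) (hσ : σ i) : σ j := by
  by_contra hn
  have hP : IsClosed (⋃ i ∈ {i | σ i}, W i) := (Set.toFinite _).isClosed_biUnion (fun i _ => hW i)
  have hQ : IsClosed (⋃ i ∈ {i | ¬ σ i}, W i) := (Set.toFinite _).isClosed_biUnion (fun i _ => hW i)
  obtain ⟨u, huS, hu1, hu2⟩ := isPreconnected_closed_iff.1 hS _ _ hP hQ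
    (fun t ht => by
      obtain ⟨i, hi⟩ := hcov t ht
      by_cases h : σ i
      · exact Or.inl (Set.mem_biUnion (show i ∈ {i | σ i} from h) hi)
      · exact Or.inr (Set.mem_biUnion (show i ∈ {i | ¬ σ i} from h) hi))
    ⟨s, hs, Set.mem_biUnion (show i ∈ {i | σ i} from hσ) hi⟩
    ⟨t, ht, Set.mem_biUnion (show j ∈ {i | ¬ σ i} from hn) hj⟩
  simp only [Set.mem_iUnion, Set.mem_ofPred_eq] at hu1 hu2
  obtain ⟨i', h1, h2⟩ := hu1
  obtain ⟨j', h3, h4⟩ := hu2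
  exact h3 (hcons u huS i' j' h2 h4 h1)

/-- the colour counts of the `j`-element halves form an interval -/
lemma half_ivt {x y : V →ₗ[ℝ] ℝ} {X : Finset V} (hX : GP x y X) (R : Finset V) (j v : ℕ)
    (hj : j ≤ X.card) (hno : ∀ Y, IsHalf x y X Y → Y.card = j → (Y ∩ R).card ≠ v) :
    (∀ Y, IsHalf x y X Y → Y.card = j → (Y ∩ R).card < v) ∨
    (∀ Y, IsHalf x y X Y → Y.card = j → v < (Y ∩ R).card) := by
  by_contra! hcon
  obtain ⟨⟨Y, hY, hYj, hYv⟩, ⟨Y', hY', hYj', hYv'⟩⟩ := hcon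
  obtain ⟨hs, α, β, h0, hl⟩ := hY
  obtain ⟨hs', α', β', h0', hl'⟩ := hY'
  let ι := {Z : Finset V // Z ∈ X.powerset ∧ Z.card = j}
  have : Finite ι := by
    have : Set.Finite {Z : Finset V | Z ∈ X.powerset ∧ Z.card = j} :=
      (X.powerset.finite_toSet).subset (fun Z hZ => hZ.1)
    exact this.to_subtype
  let W : ι → Set (ℝ × ℝ) := fun Z => {d | ∀ a ∈ Z.1, ∀ b ∈ X \ Z.1,
    d.1 * x a + d.2 * y a ≤ d.1 * x b + d.2 * y b}
  have hconn : IsPreconnected ({(0 : ℝ × ℝ)}ᶜ) :=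
    (isConnected_compl_singleton_of_one_lt_rank (by
      rw [← Module.finrank_eq_rank]; simp) _).isPreconnected
  have hnz : ∀ d : ℝ × ℝ, d ∈ ({(0 : ℝ × ℝ)}ᶜ : Set (ℝ × ℝ)) ↔ (d.1 ≠ 0 ∨ d.2 ≠ 0) := by
    intro d
    rw [Set.mem_compl_singleton_iff, Ne, Prod.ext_iff]
    simp only [Prod.fst_zero, Prod.snd_zero]
    tauto
  have key := ivt _ hconn W
    (fun Z => by
      simp only [W, Set.ofPred_forall]
      refine isClosed_iInter fun a => isClosed_iInter fun _ => isClosed_iInter fun b =>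
        isClosed_iInter fun _ => isClosed_le (by fun_prop) (by fun_prop))
    (fun Z => v ≤ (Z.1 ∩ R).card)
    (fun d hd => by
      obtain ⟨Z, hZ, hZc, hZl⟩ := exists_low X (fun a => d.1 * x a + d.2 * y a) j hj
      exact ⟨⟨Z, Finset.mem_powerset.2 hZ, hZc⟩, hZl⟩)
    (fun d hd Z Z' hZ hZ' hσ => by
      have hZX := Finset.mem_powerset.1 Z.2.1
      have hZX' := Finset.mem_powerset.1 Z'.2.1
      have t := low_tie X R Z'.1 Z.1 (fun a => d.1 * x a + d.2 * y a) hZX' hZX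
        (fun a ha b hb c hc hab hac hbc h1 h2 =>
          hX a ha b hb c hc hab hac hbc d.1 d.2 _ ((hnz d).1 hd) rfl h1.symm h2.symm)
        (by rw [Z.2.2, Z'.2.2]) hZ' hZ
      have n1 := hno Z.1 ⟨hZX, d.1, d.2, (hnz d).1 hd, hZ⟩ Z.2.2
      have n2 := hno Z'.1 ⟨hZX', d.1, d.2, (hnz d).1 hd, hZ'⟩ Z'.2.2
      omega)
    (α, β) (α', β') ((hnz _).2 h0) ((hnz _).2 h0')
    ⟨Y, Finset.mem_powerset.2 hs, hYj⟩ ⟨Y', Finset.mem_powerset.2 hs', hYj'⟩ hl hl' hYv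
  have := hno Y' ⟨hs', α', β', h0', hl'⟩ hYj'
  simp only at key
  omega

/-- the order of points along the pencil of lines through a point of the line `y = y r` -/
noncomputable def phi (x y : V →ₗ[ℝ] ℝ) (r : V) (σ u : ℝ) (q : V) : ℝ :=
  (u * σ * (x q - x r) + (1 - u)) / (y q - y r)

lemma phi_line (x y : V →ₗ[ℝ] ℝ) (r : V) (σ u : ℝ) (q : V) (hq : y q ≠ y r) :
    (u * σ) * x q + (-(phi x y r σ u q)) * y q
      = u * σ * x r - (1 - u) - phi x y r σ u q * y r := by
  have h : y q - y r ≠ 0 := sub_ne_zero.2 hq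
  have : phi x y r σ u q * (y q - y r) = u * σ * (x q - x r) + (1 - u) := by
    unfold phi; field_simp
  linarith

lemma phi_nondeg (x y : V →ₗ[ℝ] ℝ) (r : V) (σ u : ℝ) (hσ : σ ≠ 0) (q : V) (hq : y q ≠ y r) :
    u * σ ≠ 0 ∨ -(phi x y r σ u q) ≠ 0 := by
  by_cases hu : u = 0
  · right
    subst hu
    have h : y q - y r ≠ 0 := sub_ne_zero.2 hq
    simp [phi, h]
  · left
    exact mul_ne_zero hu hσ

lemma phi_tie {x y : V →ₗ[ℝ] ℝ} {X : Finset V} (hX : GP x y X) (r : V) (σ u : ℝ) (hσ : σ ≠ 0)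
    (a b c : V) (ha : a ∈ X) (hb : b ∈ X) (hc : c ∈ X) (hya : y a ≠ y r) (hyb : y b ≠ y r)
    (hyc : y c ≠ y r) (hab : a ≠ b) (hac : a ≠ c) (hbc : b ≠ c)
    (h1 : phi x y r σ u a = phi x y r σ u b) (h2 : phi x y r σ u a = phi x y r σ u c) : False := by
  refine hX a ha b hb c hc hab hac hbc _ _ _ (phi_nondeg x y r σ u hσ a hya)
    (phi_line x y r σ u a hya) ?_ ?_
  · rw [h1]; exact phi_line x y r σ u b hyb
  · rw [h2]; exact phi_line x y r σ u c hyc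

lemma phi_inj {x y : V →ₗ[ℝ] ℝ} {X : Finset V} (hX : GP x y X) (r : V) (hr : r ∈ X) (σ : ℝ)
    (hσ : σ ≠ 0) (a b : V) (ha : a ∈ X) (hb : b ∈ X) (hya : y a ≠ y r) (hyb : y b ≠ y r)
    (h1 : phi x y r σ 1 a = phi x y r σ 1 b) : a = b := by
  by_contra hab
  refine hX a ha b hb r hr hab (fun h => hya (by rw [h])) (fun h => hyb (by rw [h])) _ _ _
    (phi_nondeg x y r σ 1 hσ a hya) (phi_line x y r σ 1 a hya) ?_ ?_
  · rw [h1]; exact phi_line x y r σ 1 b hyb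
  · ring

lemma cut (x y : V →ₗ[ℝ] ℝ) (r : V) (σ u : ℝ) (hσ : σ ≠ 0) (hu : u ≤ 1) (P N : Finset V)
    (hy : ∀ q ∈ P ∪ N, q ≠ r → y q ≠ y r) (hr : r ∈ N → u = 1) (hne : ∃ q ∈ P ∪ N, q ≠ r)
    (H1 : ∀ a ∈ P, ∀ b ∈ P, y a < y r → y r < y b → phi x y r σ u a ≤ phi x y r σ u b)
    (H2 : ∀ a ∈ P, ∀ b ∈ N, y a < y r → y b < y r → phi x y r σ u a ≤ phi x y r σ u b)
    (H3 : ∀ a ∈ N, ∀ b ∈ P, y r < y a → y r < y b → phi x y r σ u a ≤ phi x y r σ u b)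
    (H4 : ∀ a ∈ N, ∀ b ∈ N, y r < y a → y b < y r → phi x y r σ u a ≤ phi x y r σ u b) :
    ∃ α β γ : ℝ, (α ≠ 0 ∨ β ≠ 0) ∧ (∀ p ∈ N, α * x p + β * y p ≤ γ) ∧
      (∀ p ∈ P, γ ≤ α * x p + β * y p) := by
  set lo := (P.filter (fun a => y a < y r)) ∪ (N.filter (fun a => y r < y a)) with hlo
  set hi := (P.filter (fun a => y r < y a)) ∪ (N.filter (fun a => y a < y r)) with hhi
  have H : ∀ a ∈ lo, ∀ b ∈ hi, phi x y r σ u a ≤ phi x y r σ u b := by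
    intro a ha b hb
    simp only [hlo, hhi, Finset.mem_union, Finset.mem_filter] at ha hb
    rcases ha with ⟨ha, ha'⟩ | ⟨ha, ha'⟩ <;> rcases hb with ⟨hb, hb'⟩ | ⟨hb, hb'⟩
    · exact H1 a ha b hb ha' hb'
    · exact H2 a ha b hb ha' hb'
    · exact H3 a ha b hb ha' hb'
    · exact H4 a ha b hb ha' hb'
  have hL : ∃ q, y q ≠ y r ∧ (∀ a ∈ lo, phi x y r σ u a ≤ phi x y r σ u q) ∧
      (∀ a ∈ hi, phi x y r σ u q ≤ phi x y r σ u a) := by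
    rcases lo.eq_empty_or_nonempty with h | h
    · have hhine : hi.Nonempty := by
        obtain ⟨q, hq, hqr⟩ := hne
        have hyq := hy q hq hqr
        have hnot : q ∉ lo := by rw [h]; simp
        refine ⟨q, ?_⟩
        simp only [hlo, hhi, Finset.mem_union, Finset.mem_filter] at hq hnot ⊢
        rcases lt_or_gt_of_ne hyq with h' | h' <;> tauto
      obtain ⟨q, hq, hmin⟩ := hi.exists_min_image (phi x y r σ u) hhine
      refine ⟨q, ?_, by simp [h], hmin⟩
      simp only [hhi, Finset.mem_union, Finset.mem_filter] at hq
      rcases hq with hq | hq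
      · exact hq.2.ne'
      · exact hq.2.ne
    · obtain ⟨q, hq, hmax⟩ := lo.exists_max_image (phi x y r σ u) h
      refine ⟨q, ?_, hmax, fun a ha => H q hq a ha⟩
      simp only [hlo, Finset.mem_union, Finset.mem_filter] at hq
      rcases hq with hq | hq
      · exact hq.2.ne
      · exact hq.2.ne'
  obtain ⟨q, hyq, hq1, hq2⟩ := hL
  set l := phi x y r σ u q with hl
  refine ⟨u * σ, -l, u * σ * x r - (1 - u) - l * y r, phi_nondeg x y r σ u hσ q hyq, ?_, ?_⟩
  · intro p hp
    by_cases hpr : p = r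
    · have h1 := hr (hpr ▸ hp)
      subst hpr
      subst h1
      linarith
    have hyp := hy p (Finset.mem_union_right _ hp) hpr
    have hline := phi_line x y r σ u p hyp
    rcases lt_or_gt_of_ne hyp with h' | h'
    · have := hq2 p (by simp only [hhi, Finset.mem_union, Finset.mem_filter]; tauto)
      nlinarith
    · have := hq1 p (by simp only [hlo, Finset.mem_union, Finset.mem_filter]; tauto)
      nlinarith
  · intro p hp
    by_cases hpr : p = r
    · subst hpr
      linarith
    have hyp := hy p (Finset.mem_union_left _ hp) hpr
    have hline := phi_line x y r σ u p hyp
    rcases lt_or_gt_of_ne hyp with h' | h'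
    · have := hq1 p (by simp only [hlo, Finset.mem_union, Finset.mem_filter]; tauto)
      nlinarith
    · have := hq2 p (by simp only [hhi, Finset.mem_union, Finset.mem_filter]; tauto)
      nlinarith

lemma cut_sep {x y : V →ₗ[ℝ] ℝ} {X : Finset V} (hX : GP x y X) (r : V)
    (hyX : ∀ q ∈ X, q ≠ r → y q ≠ y r) (σ u : ℝ) (hσ : σ ≠ 0) (hu : u ≤ 1)
    (P N : Finset V) (hP : P ⊆ X) (hN : N ⊆ X) (hd : Disjoint P N)
    (hr : r ∈ N → u = 1)
    (H1 : ∀ a ∈ P, ∀ b ∈ P, y a < y r → y r < y b → phi x y r σ u a ≤ phi x y r σ u b)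
    (H2 : ∀ a ∈ P, ∀ b ∈ N, y a < y r → y b < y r → phi x y r σ u a ≤ phi x y r σ u b)
    (H3 : ∀ a ∈ N, ∀ b ∈ P, y r < y a → y r < y b → phi x y r σ u a ≤ phi x y r σ u b)
    (H4 : ∀ a ∈ N, ∀ b ∈ N, y r < y a → y b < y r → phi x y r σ u a ≤ phi x y r σ u b) :
    Disjoint (convexHull ℝ (P : Set V)) (convexHull ℝ (N : Set V)) := by
  by_cases hne : ∃ q ∈ P ∪ N, q ≠ r
  · obtain ⟨α, β, γ, h0, h1, h2⟩ := cut x y r σ u hσ hu P N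
      (fun q hq => hyX q (Finset.union_subset hP hN hq)) hr hne H1 H2 H3 H4
    exact (sep hX hN hP hd.symm α β γ h0 h1 h2).symm
  · push Not at hne
    rcases P.eq_empty_or_nonempty with rfl | ⟨p, hp⟩
    · simp
    rcases N.eq_empty_or_nonempty with rfl | ⟨p', hp'⟩
    · simp
    exfalso
    have e1 := hne p (Finset.mem_union_left _ hp)
    have e2 := hne p' (Finset.mem_union_right _ hp')
    exact Finset.disjoint_left.1 hd hp (by rw [e1, ← e2]; exact hp')

lemma cut_half {x y : V →ₗ[ℝ] ℝ} {X : Finset V} (r : V)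
    (hyX : ∀ q ∈ X, q ≠ r → y q ≠ y r) (σ u : ℝ) (hσ : σ ≠ 0) (hu : u ≤ 1)
    (P N : Finset V) (hPN : P ∪ N = X) (hd : Disjoint P N) (hne : ∃ q ∈ X, q ≠ r)
    (hr : r ∈ N → u = 1)
    (H1 : ∀ a ∈ P, ∀ b ∈ P, y a < y r → y r < y b → phi x y r σ u a ≤ phi x y r σ u b)
    (H2 : ∀ a ∈ P, ∀ b ∈ N, y a < y r → y b < y r → phi x y r σ u a ≤ phi x y r σ u b)
    (H3 : ∀ a ∈ N, ∀ b ∈ P, y r < y a → y r < y b → phi x y r σ u a ≤ phi x y r σ u b)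
    (H4 : ∀ a ∈ N, ∀ b ∈ N, y r < y a → y b < y r → phi x y r σ u a ≤ phi x y r σ u b) :
    IsHalf x y X N ∧ IsHalf x y X P := by
  obtain ⟨α, β, γ, h0, h1, h2⟩ := cut x y r σ u hσ hu P N
      (fun q hq => hyX q (hPN ▸ hq)) hr (by rwa [hPN]) H1 H2 H3 H4
  have hXN : X \ N = P := by
    rw [← hPN, Finset.union_sdiff_right, Finset.sdiff_eq_self_of_disjoint hd]
  have hN : IsHalf x y X N := by
    refine ⟨hPN ▸ Finset.subset_union_right, α, β, h0, ?_⟩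
    intro a ha b hb
    rw [hXN] at hb
    exact (h1 a ha).trans (h2 b hb)
  exact ⟨hN, hXN ▸ hN.compl⟩

/-- there is no good partition into three parts with disjoint hulls -/
def NoTri (X R : Finset V) (k m m' : ℕ) : Prop :=
  ∀ Y1 Y2 Y3 : Finset V, Y1 ∪ Y2 ∪ Y3 = X → Disjoint Y1 Y2 → Disjoint Y1 Y3 → Disjoint Y2 Y3 →
    Y1.card = k → Y2.card = k * m → Y3.card = k * m' →
    (Y1 ∩ R).card = 1 → (Y2 ∩ R).card = m → (Y3 ∩ R).card = m' →
    Disjoint (convexHull ℝ (Y1 : Set V)) (convexHull ℝ (Y2 : Set V)) →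
    Disjoint (convexHull ℝ (Y1 : Set V)) (convexHull ℝ (Y3 : Set V)) →
    Disjoint (convexHull ℝ (Y2 : Set V)) (convexHull ℝ (Y3 : Set V)) → False

lemma NoTri.swap {X R : Finset V} {k m m' : ℕ} (h : NoTri X R k m m') : NoTri X R k m' m := by
  intro Y1 Y2 Y3 hu h12 h13 h23 c1 c2 c3 r1 r2 r3 d12 d13 d23
  exact h Y1 Y3 Y2 (by rw [← hu]; ext; simp only [Finset.mem_union]; tauto) h13 h12 h23.symm c1 c3 c2
    r1 r3 r2 d13 d12 d23.symm

structure Setup (x y : V →ₗ[ℝ] ℝ) (X R : Finset V) (r : V) (k m m' : ℕ) : Prop where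
  gp : GP x y X
  rX : r ∈ X
  rR : r ∈ R
  RX : R ⊆ X
  hy : ∀ q ∈ X, q ≠ r → y q ≠ y r
  low : ∀ q ∈ R, q ≠ r → y r < y q
  cardX : X.card = k * (m + m' + 1)
  cardR : R.card = m + m' + 1
  hBe : k ≤ (X.filter (fun a => y a < y r)).card
  hAb : k * m < (X.filter (fun a => y r < y a)).card
  hhalf : ∀ Y, IsHalf x y X Y → Y.card = k * m' → (Y ∩ R).card < m'
  ng : NoTri X R k m m'

lemma count3 (X Y1 Y2 : Finset V) (h1 : Y1 ⊆ X) (h2 : Y2 ⊆ X) (hd : Disjoint Y1 Y2) :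
    Y1.card + Y2.card + (X \ (Y1 ∪ Y2)).card = X.card := by
  rw [← Finset.card_union_of_disjoint hd, add_comm,
    Finset.card_sdiff_add_card_eq_card (Finset.union_subset h1 h2)]

lemma count3R (X R Y1 Y2 : Finset V) (hR : R ⊆ X) (hd : Disjoint Y1 Y2) :
    (Y1 ∩ R).card + (Y2 ∩ R).card + ((X \ (Y1 ∪ Y2)) ∩ R).card = R.card := by
  have h := count3 R (Y1 ∩ R) (Y2 ∩ R) Finset.inter_subset_right Finset.inter_subset_right
    (hd.mono Finset.inter_subset_left Finset.inter_subset_left)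
  rw [← h]
  congr 2
  ext a
  simp only [Finset.mem_inter, Finset.mem_sdiff, Finset.mem_union]
  constructor
  · tauto
  · rintro ⟨h1, h2⟩
    have := hR h1
    tauto

section
variable {x y : V →ₗ[ℝ] ℝ} {X R : Finset V} {r : V} {k m m' : ℕ}

lemma Setup.blue (S : Setup x y X R r k m m') {a : V} (ha : y a < y r) : a ∉ R := by
  intro h
  by_cases har : a = r
  · rw [har] at ha; exact lt_irrefl _ ha
  · exact absurd (S.low a h har) (by linarith)

lemma Setup.redOne (S : Setup x y X R r k m m') {Z : Finset V} (hZ : ∀ z ∈ Z, y z < y r) :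
    ((insert r Z) ∩ R).card = 1 := by
  have : (insert r Z) ∩ R = {r} := by
    ext a
    simp only [Finset.mem_inter, Finset.mem_insert, Finset.mem_singleton]
    constructor
    · rintro ⟨h | h, h2⟩
      · exact h
      · exact absurd h2 (S.blue (hZ a h))
    · rintro rfl
      exact ⟨Or.inl rfl, S.rR⟩
  rw [this, Finset.card_singleton]

lemma Setup.counts (S : Setup x y X R r k m m') {Z Y2 : Finset V} (hZX : Z ⊆ X)
    (hZ : ∀ z ∈ Z, y z < y r) (hY2 : Y2 ⊆ X) (hrY : r ∉ Y2) (hd : Disjoint Z Y2)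
    (hZc : Z.card + 1 = k) (hYc : Y2.card = k * m) :
    (X \ (insert r Z ∪ Y2)).card = k * m' ∧
    (Y2 ∩ R).card + ((X \ (insert r Z ∪ Y2)) ∩ R).card = m + m' := by
  have hrZ : r ∉ Z := fun h => lt_irrefl _ (hZ r h)
  have hd' : Disjoint (insert r Z) Y2 := Finset.disjoint_insert_left.2 ⟨hrY, hd⟩
  have h1 := count3 X (insert r Z) Y2 (Finset.insert_subset S.rX hZX) hY2 hd'
  have h2 := count3R X R (insert r Z) Y2 S.RX hd'
  rw [Finset.card_insert_of_notMem hrZ, hZc, hYc, S.cardX] at h1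
  rw [S.redOne hZ, S.cardR] at h2
  constructor
  · have : k * (m + m' + 1) = k * m + k * m' + k := by ring
    omega
  · omega

lemma Setup.tri_good (S : Setup x y X R r k m m') (σ u : ℝ) (hσ : σ ≠ 0) (hu : u ≤ 1)
    {Z Y2 : Finset V} (hZX : Z ⊆ X)
    (hZ : ∀ z ∈ Z, y z < y r) (hY2 : Y2 ⊆ X) (hrY : r ∉ Y2) (hd : Disjoint Z Y2)
    (hZc : Z.card + 1 = k) (hYc : Y2.card = k * m) (hred : (Y2 ∩ R).card = m)
    (h12 : Disjoint (convexHull ℝ ((insert r Z : Finset V) : Set V)) (convexHull ℝ (Y2 : Set V)))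
    (Y3 : Finset V) (hY3 : Y3 = X \ (insert r Z ∪ Y2))
    (H2 : ∀ a ∈ Z, ∀ b ∈ Y3, y b < y r → phi x y r σ u a ≤ phi x y r σ u b)
    (H4 : ∀ a ∈ Y3, ∀ b ∈ Y3, y r < y a → y b < y r → phi x y r σ u a ≤ phi x y r σ u b)
    (H1' : ∀ a ∈ Y2, ∀ b ∈ Y2, y a < y r → y r < y b → phi x y r σ u a ≤ phi x y r σ u b)
    (H2' : ∀ a ∈ Y2, ∀ b ∈ Y3, y a < y r → y b < y r → phi x y r σ u a ≤ phi x y r σ u b)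
    (H3' : ∀ a ∈ Y3, ∀ b ∈ Y2, y r < y a → y r < y b → phi x y r σ u a ≤ phi x y r σ u b) :
    False := by
  have hrZ : r ∉ Z := fun h => lt_irrefl _ (hZ r h)
  have hd' : Disjoint (insert r Z) Y2 := Finset.disjoint_insert_left.2 ⟨hrY, hd⟩
  obtain ⟨c3, r3⟩ := S.counts hZX hZ hY2 hrY hd hZc hYc
  rw [← hY3] at c3 r3
  have hsub : insert r Z ∪ Y2 ⊆ X := Finset.union_subset (Finset.insert_subset S.rX hZX) hY2
  have hdd : Disjoint (insert r Z ∪ Y2) Y3 := hY3 ▸ Finset.disjoint_sdiff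
  have hd13 : Disjoint (insert r Z) Y3 := hdd.mono_left Finset.subset_union_left
  have hd23 : Disjoint Y2 Y3 := hdd.mono_left Finset.subset_union_right
  have hY3X : Y3 ⊆ X := hY3 ▸ Finset.sdiff_subset
  have hrY3 : r ∉ Y3 := fun h => Finset.disjoint_left.1 hd13 (Finset.mem_insert_self _ _) h
  refine S.ng (insert r Z) Y2 Y3 (by rw [hY3, Finset.union_sdiff_of_subset hsub]) hd' hd13 hd23
    (by rw [Finset.card_insert_of_notMem hrZ, hZc]) hYc c3 (S.redOne hZ) hred (by omega) h12 ?_ ?_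
  · refine cut_sep S.gp r S.hy σ u hσ hu _ _ (Finset.insert_subset S.rX hZX) hY3X hd13
      (fun h => absurd h hrY3) ?_ ?_ ?_ H4
    · intro a _ b hb _ h
      rcases Finset.mem_insert.1 hb with rfl | hb
      · exact absurd h (lt_irrefl _)
      · exact absurd (hZ b hb) (by linarith)
    · intro a ha b hb h h'
      rcases Finset.mem_insert.1 ha with rfl | ha
      · exact absurd h (lt_irrefl _)
      · exact H2 a ha b hb h'
    · intro a _ b hb _ h
      rcases Finset.mem_insert.1 hb with rfl | hb
      · exact absurd h (lt_irrefl _)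
      · exact absurd (hZ b hb) (by linarith)
  · exact cut_sep S.gp r S.hy σ u hσ hu _ _ hY2 hY3X hd23 (fun h => absurd h hrY3) H1' H2' H3' H4

lemma Setup.exists_ne (S : Setup x y X R r k m m') : ∃ q ∈ X, q ≠ r := by
  have : 0 < (X.filter (fun a => y r < y a)).card := lt_of_le_of_lt (Nat.zero_le _) S.hAb
  obtain ⟨q, hq⟩ := Finset.card_pos.1 this
  rw [Finset.mem_filter] at hq
  exact ⟨q, hq.1, fun h => by rw [h] at hq; exact lt_irrefl _ hq.2⟩

lemma Setup.tri_half (S : Setup x y X R r k m m') (σ u : ℝ) (hσ : σ ≠ 0) (hu : u ≤ 1)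
    {Z Y2 : Finset V} (hZX : Z ⊆ X)
    (hZ : ∀ z ∈ Z, y z < y r) (hY2 : Y2 ⊆ X) (hrY : r ∉ Y2) (hd : Disjoint Z Y2)
    (hZc : Z.card + 1 = k) (hYc : Y2.card = k * m)
    (Y3 : Finset V) (hY3 : Y3 = X \ (insert r Z ∪ Y2))
    (H1 : ∀ a ∈ Z ∪ Y2, ∀ b ∈ Y2, y a < y r → y r < y b → phi x y r σ u a ≤ phi x y r σ u b)
    (H2 : ∀ a ∈ Z ∪ Y2, ∀ b ∈ Y3, y a < y r → y b < y r → phi x y r σ u a ≤ phi x y r σ u b)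
    (H3 : ∀ a ∈ Y3, ∀ b ∈ Y2, y r < y a → y r < y b → phi x y r σ u a ≤ phi x y r σ u b)
    (H4 : ∀ a ∈ Y3, ∀ b ∈ Y3, y r < y a → y b < y r → phi x y r σ u a ≤ phi x y r σ u b) :
    m + 1 ≤ (Y2 ∩ R).card := by
  obtain ⟨c3, r3⟩ := S.counts hZX hZ hY2 hrY hd hZc hYc
  rw [← hY3] at c3 r3
  have hsub : insert r Z ∪ Y2 ⊆ X := Finset.union_subset (Finset.insert_subset S.rX hZX) hY2
  have hdd : Disjoint (insert r Z ∪ Y2) Y3 := hY3 ▸ Finset.disjoint_sdiff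
  have hrY3 : r ∉ Y3 := fun h => Finset.disjoint_left.1 hdd
    (Finset.mem_union_left _ (Finset.mem_insert_self _ _)) h
  have hlo : ∀ a ∈ insert r Z ∪ Y2, y a < y r → a ∈ Z ∪ Y2 := by
    intro a ha h
    rw [Finset.insert_union, Finset.mem_insert] at ha
    rcases ha with rfl | ha
    · exact absurd h (lt_irrefl _)
    · exact ha
  have hhi : ∀ a ∈ insert r Z ∪ Y2, y r < y a → a ∈ Y2 := by
    intro a ha h
    rw [Finset.insert_union, Finset.mem_insert, Finset.mem_union] at ha
    rcases ha with rfl | ha | ha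
    · exact absurd h (lt_irrefl _)
    · exact absurd (hZ a ha) (by linarith)
    · exact ha
  have hh := cut_half (x := x) r S.hy σ u hσ hu (insert r Z ∪ Y2) Y3
    (by rw [hY3, Finset.union_sdiff_of_subset hsub]) hdd S.exists_ne (fun h => absurd h hrY3)
    (fun a ha b hb h h' => H1 a (hlo a ha h) b (hhi b hb h') h h')
    (fun a ha b hb h h' => H2 a (hlo a ha h) b hb h h')
    (fun a ha b hb h h' => H3 a ha b (hhi b hb h') h h') H4
  have := S.hhalf Y3 hh.1 c3
  omega

lemma low_le (S' Z Z' : Finset V) (f : V → ℝ) (hZ : Z ⊆ S') (hc : Z.card = Z'.card)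
    (hl : ∀ a ∈ Z, ∀ b ∈ S' \ Z, f a ≤ f b) (hl' : ∀ a ∈ Z', ∀ b ∈ S' \ Z', f a ≤ f b)
    (z : V) (hz : z ∈ Z') (b : V) (hb : b ∈ S' \ Z) : f z ≤ f b := by
  by_cases h : z ∈ Z
  · exact hl z h b hb
  · have : ∃ w ∈ Z, w ∉ Z' := by
      by_contra! hcon
      have := Finset.eq_of_subset_of_card_le (s := Z) (t := Z') hcon hc.ge
      exact h (this ▸ hz)
    obtain ⟨w, hw, hw'⟩ := this
    exact (hl' z hz w (Finset.mem_sdiff.2 ⟨hZ hw, hw'⟩)).trans (hl w hw b hb)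

lemma Setup.phase1 (S : Setup x y X R r k m m') (σ : ℝ) (hσ : σ ≠ 0) (Ab Be : Finset V)
    (hAb : Ab = X.filter (fun a => y r < y a)) (hBe : Be = X.filter (fun a => y a < y r))
    (Y2 Z : Finset V) (hY2 : Y2 ⊆ Ab) (hZ : Z ⊆ Be) (hYc : Y2.card = k * m) (hZc : Z.card + 1 = k)
    (hYl : ∀ a ∈ Y2, ∀ b ∈ Ab \ Y2, phi x y r σ 1 b ≤ phi x y r σ 1 a)
    (hZl : ∀ a ∈ Z, ∀ b ∈ Be \ Z, phi x y r σ 1 a ≤ phi x y r σ 1 b)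
    (hconv : ∀ a ∈ Ab \ Y2, ∀ b ∈ Be \ Z, phi x y r σ 1 a ≤ phi x y r σ 1 b) :
    m + 1 ≤ (Y2 ∩ R).card := by
  have mAb : ∀ a, a ∈ Ab ↔ a ∈ X ∧ y r < y a := fun a => by rw [hAb, Finset.mem_filter]
  have mBe : ∀ a, a ∈ Be ↔ a ∈ X ∧ y a < y r := fun a => by rw [hBe, Finset.mem_filter]
  have cBe : k ≤ Be.card := hBe ▸ S.hBe
  have cAb : k * m < Ab.card := hAb ▸ S.hAb
  have hAbX : Ab ⊆ X := fun a ha => ((mAb a).1 ha).1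
  have hBeX : Be ⊆ X := fun a ha => ((mBe a).1 ha).1
  have m3 : ∀ (Y2 Z : Finset V), Y2 ⊆ Ab → Z ⊆ Be → ∀ a ∈ X \ (insert r Z ∪ Y2),
      (y r < y a → a ∈ Ab \ Y2) ∧ (y a < y r → a ∈ Be \ Z) := by
    intro Y2 Z _ _ a ha
    simp only [Finset.mem_sdiff, Finset.mem_union, Finset.mem_insert, not_or] at ha
    simp only [Finset.mem_sdiff, mAb, mBe]
    tauto
  have basics : ∀ (Y2 Z : Finset V), Y2 ⊆ Ab → Z ⊆ Be → (∀ z ∈ Z, y z < y r) ∧ r ∉ Y2 ∧ Disjoint Z Y2 := by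
    intro Y2 Z h1 h2
    refine ⟨fun z hz => ((mBe z).1 (h2 hz)).2, fun h => lt_irrefl _ ((mAb r).1 (h1 h)).2, ?_⟩
    rw [Finset.disjoint_left]
    intro a ha ha'
    have e1 := ((mBe a).1 (h2 ha)).2
    have e2 := ((mAb a).1 (h1 ha')).2
    linarith
  let ι := {p : Finset V × Finset V // p ∈ Ab.powerset ×ˢ Be.powerset ∧
    p.1.card = k * m ∧ p.2.card + 1 = k} × Bool
  have : Finite {p : Finset V × Finset V // p ∈ Ab.powerset ×ˢ Be.powerset ∧
    p.1.card = k * m ∧ p.2.card + 1 = k} := by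
    have : Set.Finite {p : Finset V × Finset V | p ∈ Ab.powerset ×ˢ Be.powerset ∧
        p.1.card = k * m ∧ p.2.card + 1 = k} :=
      ((Ab.powerset ×ˢ Be.powerset).finite_toSet).subset (fun Z hZ => hZ.1)
    exact this.to_subtype
  have hfin : Finite ι := inferInstance
  let W : ι → Set ℝ := fun i =>
    {u | (∀ a ∈ i.1.1.1, ∀ b ∈ Ab \ i.1.1.1, phi x y r σ u b ≤ phi x y r σ u a) ∧
      (∀ a ∈ i.1.1.2, ∀ b ∈ Be \ i.1.1.2, phi x y r σ u a ≤ phi x y r σ u b) ∧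
      ((i.2 = true ∧ ∀ a ∈ Ab \ i.1.1.1, ∀ b ∈ Be \ i.1.1.2, phi x y r σ u a ≤ phi x y r σ u b) ∨
       (i.2 = false ∧ ∃ a ∈ Ab \ i.1.1.1, ∃ b ∈ Be \ i.1.1.2, phi x y r σ u b ≤ phi x y r σ u a))}
  have hcont : ∀ q, Continuous (fun u => phi x y r σ u q) := fun q => by unfold phi; fun_prop
  have hclle : ∀ (s t : Finset V), IsClosed {u | ∀ a ∈ s, ∀ b ∈ t, phi x y r σ u a ≤ phi x y r σ u b} := by
    intro s t
    simp only [Set.ofPred_forall]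
    exact isClosed_iInter fun a => isClosed_iInter fun _ => isClosed_iInter fun b =>
        isClosed_iInter fun _ => isClosed_le (hcont _) (hcont _)
  have hclle' : ∀ (s t : Finset V), IsClosed {u | ∀ a ∈ s, ∀ b ∈ t, phi x y r σ u b ≤ phi x y r σ u a} := by
    intro s t
    simp only [Set.ofPred_forall]
    exact isClosed_iInter fun a => isClosed_iInter fun _ => isClosed_iInter fun b =>
        isClosed_iInter fun _ => isClosed_le (hcont _) (hcont _)
  have hclex : ∀ (s t : Finset V), IsClosed {u | ∃ a ∈ s, ∃ b ∈ t, phi x y r σ u b ≤ phi x y r σ u a} := by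
    intro s t
    have : {u | ∃ a ∈ s, ∃ b ∈ t, phi x y r σ u b ≤ phi x y r σ u a} =
        ⋃ a ∈ (s : Set V), ⋃ b ∈ (t : Set V), {u | phi x y r σ u b ≤ phi x y r σ u a} := by
      ext u; simp
    rw [this]
    exact s.finite_toSet.isClosed_biUnion fun a _ => t.finite_toSet.isClosed_biUnion fun b _ =>
      isClosed_le (hcont _) (hcont _)
  have hex : ∀ u, ∃ i : {p : Finset V × Finset V // p ∈ Ab.powerset ×ˢ Be.powerset ∧
    p.1.card = k * m ∧ p.2.card + 1 = k}, 
      (∀ a ∈ i.1.1, ∀ b ∈ Ab \ i.1.1, phi x y r σ u b ≤ phi x y r σ u a) ∧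
      (∀ a ∈ i.1.2, ∀ b ∈ Be \ i.1.2, phi x y r σ u a ≤ phi x y r σ u b) := by
    intro u
    obtain ⟨P, hP, hPc, hPl⟩ := exists_low Ab (fun a => - phi x y r σ u a) (k * m) cAb.le
    obtain ⟨Q, hQ, hQc, hQl⟩ := exists_low Be (phi x y r σ u) (k - 1) (by omega)
    refine ⟨⟨(P, Q), ?_, hPc, ?_⟩, ?_, hQl⟩
    · simp [hP, hQ]
    · simp only [hQc]; omega
    · intro a ha b hb
      have := hPl a ha b hb
      linarith
  obtain ⟨i0, hi0, hi0'⟩ := hex 0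
  have hsub : ∀ i : {p : Finset V × Finset V // p ∈ Ab.powerset ×ˢ Be.powerset ∧
    p.1.card = k * m ∧ p.2.card + 1 = k}, i.1.1 ⊆ Ab ∧ i.1.2 ⊆ Be := by
    intro i
    have := i.2.1
    rw [Finset.mem_product, Finset.mem_powerset, Finset.mem_powerset] at this
    exact this
  have key := ivt (Set.Icc (0 : ℝ) 1) isPreconnected_Icc W
    (fun i => by
      refine (hclle' _ _).inter ((hclle _ _).inter (IsClosed.union ?_ ?_))
      · exact IsClosed.inter isClosed_const (hclle _ _)
      · exact IsClosed.inter isClosed_const (hclex _ _))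
    (fun i => i.2 = false ∨ m + 1 ≤ (i.1.1.1 ∩ R).card)
    (fun u hu => by
      obtain ⟨i, h1, h2⟩ := hex u
      by_cases h : ∀ a ∈ Ab \ i.1.1, ∀ b ∈ Be \ i.1.2, phi x y r σ u a ≤ phi x y r σ u b
      · exact ⟨(i, true), h1, h2, Or.inl ⟨rfl, h⟩⟩
      · push Not at h
        obtain ⟨a, ha, b, hb, hab⟩ := h
        exact ⟨(i, false), h1, h2, Or.inr ⟨rfl, a, ha, b, hb, hab.le⟩⟩)
    (fun u hu i j hi hj hσi => by
      obtain ⟨hsi, hsi'⟩ := hsub i.1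
      obtain ⟨hsj, hsj'⟩ := hsub j.1
      obtain ⟨hi1, hi2, hi3⟩ := hi
      obtain ⟨hj1, hj2, hj3⟩ := hj
      rcases hj3 with ⟨hjt, hj3⟩ | ⟨hjf, -⟩
      swap
      · exact Or.inl hjf
      obtain ⟨bj1, bj2, bj3⟩ := basics _ _ hsj hsj'
      have m3j := m3 _ _ hsj hsj'
      have nogood : (j.1.1.1 ∩ R).card ≠ m := by
        intro hred
        refine S.tri_good σ u hσ hu.2 (hsj'.trans hBeX) bj1 (hsj.trans hAbX) bj2 bj3 j.1.2.2.2
          j.1.2.2.1 hred ?_ _ rfl ?_ ?_ ?_ ?_ ?_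
        · refine sep S.gp (Finset.insert_subset S.rX (hsj'.trans hBeX)) (hsj.trans hAbX)
            (Finset.disjoint_insert_left.2 ⟨bj2, bj3⟩) 0 1 (y r) (by simp) ?_ ?_
          · intro a ha
            rcases Finset.mem_insert.1 ha with rfl | ha
            · simp
            · have := bj1 a ha
              linarith
          · intro a ha
            have := ((mAb a).1 (hsj ha)).2
            linarith
        · intro a ha b hb h
          exact hj2 a ha b ((m3j b hb).2 h)
        · intro a ha b hb h h'
          exact hj3 a ((m3j a ha).1 h) b ((m3j b hb).2 h')
        · intro a ha b hb h
          exact absurd ((mAb a).1 (hsj ha)).2 (by linarith)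
        · intro a ha b hb h
          exact absurd ((mAb a).1 (hsj ha)).2 (by linarith)
        · intro a ha b hb h h'
          exact hj1 b hb a ((m3j a ha).1 h)
      rcases hi3 with ⟨hit, -⟩ | ⟨-, a0, ha0, b0, hb0, hab0⟩
      · right
        have hri : m + 1 ≤ (i.1.1.1 ∩ R).card := by
          rcases hσi with h | h
          · rw [hit] at h; cases h
          · exact h
        have t := low_tie Ab R j.1.1.1 i.1.1.1 (fun a => - phi x y r σ u a) hsj hsi
          (fun a ha b hb c hc hab hac hbc h1 h2 =>
            phi_tie S.gp r σ u hσ a b c (hAbX ha) (hAbX hb) (hAbX hc) ((mAb a).1 ha).2.ne'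
              ((mAb b).1 hb).2.ne' ((mAb c).1 hc).2.ne' hab hac hbc (neg_injective h1) (neg_injective h2))
          (by rw [i.1.2.2.1, j.1.2.2.1])
          (fun a ha b hb => neg_le_neg (hj1 a ha b hb)) (fun a ha b hb => neg_le_neg (hi1 a ha b hb))
        omega
      · right
        refine S.tri_half σ u hσ hu.2 (hsj'.trans hBeX) bj1 (hsj.trans hAbX) bj2 bj3 j.1.2.2.2
          j.1.2.2.1 _ rfl ?_ ?_ ?_ ?_
        · intro a ha b hb h h'
          rcases Finset.mem_union.1 ha with ha | ha
          swap
          · exact absurd ((mAb a).1 (hsj ha)).2 (by linarith)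
          have e1 := low_le Be i.1.1.2 j.1.1.2 (phi x y r σ u) hsi'
            (by have := i.1.2.2.2; have := j.1.2.2.2; omega) hi2 hj2 a ha b0 hb0
          have e2 := low_le Ab i.1.1.1 j.1.1.1 (fun a => - phi x y r σ u a) hsi
            (by rw [i.1.2.2.1, j.1.2.2.1]) (fun a ha b hb => neg_le_neg (hi1 a ha b hb))
            (fun a ha b hb => neg_le_neg (hj1 a ha b hb)) b hb a0 ha0
          linarith
        · intro a ha b hb h h'
          rcases Finset.mem_union.1 ha with ha | ha
          swap
          · exact absurd ((mAb a).1 (hsj ha)).2 (by linarith)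
          exact hj2 a ha b ((m3j b hb).2 h')
        · intro a ha b hb h h'
          exact hj1 b hb a ((m3j a ha).1 h)
        · intro a ha b hb h h'
          exact hj3 a ((m3j a ha).1 h) b ((m3j b hb).2 h'))
    0 1 (by simp) (by simp) (i0, false) (⟨(Y2, Z), by simp [hY2, hZ], hYc, hZc⟩, true)
    (by
      refine ⟨hi0, hi0', Or.inr ⟨rfl, ?_⟩⟩
      obtain ⟨h1, h2⟩ := hsub i0
      obtain ⟨a, ha⟩ : (Ab \ i0.1.1).Nonempty := by
        rw [← Finset.card_pos, Finset.card_sdiff_of_subset h1, i0.2.2.1]; omega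
      obtain ⟨b, hb⟩ : (Be \ i0.1.2).Nonempty := by
        have := i0.2.2.2
        rw [← Finset.card_pos, Finset.card_sdiff_of_subset h2]; omega
      refine ⟨a, ha, b, hb, ?_⟩
      have ha' := ((mAb a).1 (Finset.mem_sdiff.1 ha).1).2
      have hb' := ((mBe b).1 (Finset.mem_sdiff.1 hb).1).2
      have e1 : phi x y r σ 0 b ≤ 0 := by
        unfold phi
        apply div_nonpos_of_nonneg_of_nonpos <;> simp <;> linarith
      have e2 : 0 ≤ phi x y r σ 0 a := by
        unfold phi
        apply div_nonneg <;> simp <;> linarith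
      linarith)
    ⟨hYl, hZl, Or.inl ⟨rfl, hconv⟩⟩ (Or.inl rfl)
  rcases key with h | h
  · cases h
  · exact h
end

lemma chain (S' : Finset V) (f : V → ℝ) (hf : ∀ a ∈ S', ∀ b ∈ S', f a = f b → a = b) :
    ∃ L : ℕ → Finset V, (∀ j ≤ S'.card, L j ⊆ S') ∧ (∀ j ≤ S'.card, (L j).card = j) ∧
      (∀ j ≤ S'.card, ∀ a ∈ L j, ∀ b ∈ S' \ L j, f a ≤ f b) ∧
      (∀ j j', j ≤ j' → j' ≤ S'.card → L j ⊆ L j') ∧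
      (∀ j < S'.card, ∀ a ∈ L (j + 1), ∀ b ∈ S' \ L j, f a ≤ f b) := by
  have : ∀ j, ∃ Y, j ≤ S'.card → Y ⊆ S' ∧ Y.card = j ∧ ∀ a ∈ Y, ∀ b ∈ S' \ Y, f a ≤ f b := by
    intro j
    by_cases h : j ≤ S'.card
    · obtain ⟨Y, h1, h2⟩ := exists_low S' f j h
      exact ⟨Y, fun _ => ⟨h1, h2⟩⟩
    · exact ⟨∅, fun h' => absurd h' h⟩
  choose L hL using this
  have hmono : ∀ j j', j ≤ j' → j' ≤ S'.card → L j ⊆ L j' := by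
    intro j j' hjj hj'
    obtain ⟨s1, c1, l1⟩ := hL j (hjj.trans hj')
    obtain ⟨s2, c2, l2⟩ := hL j' hj'
    intro a ha
    by_contra hn
    have : ∃ b ∈ L j', b ∉ L j := by
      by_contra! hcon
      have := Finset.eq_of_subset_of_card_le (s := L j') (t := L j) hcon (by omega)
      exact hn (this ▸ ha)
    obtain ⟨b, hb, hb'⟩ := this
    have e1 := l1 a ha b (Finset.mem_sdiff.2 ⟨s2 hb, hb'⟩)
    have e2 := l2 b hb a (Finset.mem_sdiff.2 ⟨s1 ha, hn⟩)
    have := hf a (s1 ha) b (s2 hb) (le_antisymm e1 e2)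
    exact hn (this ▸ hb)
  refine ⟨L, fun j hj => (hL j hj).1, fun j hj => (hL j hj).2.1, fun j hj => (hL j hj).2.2, hmono, ?_⟩
  intro j hj a ha b hb
  obtain ⟨s1, c1, l1⟩ := hL j hj.le
  obtain ⟨s2, c2, l2⟩ := hL (j + 1) hj
  by_cases haj : a ∈ L j
  · exact l1 a haj b hb
  by_cases hbj : b ∈ L (j + 1)
  · have : (L (j + 1) \ L j).card ≤ 1 := by
      rw [Finset.card_sdiff_of_subset (hmono j (j + 1) (by omega) hj)]; omega
    have := Finset.card_le_one.1 this a (Finset.mem_sdiff.2 ⟨ha, haj⟩) b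
      (Finset.mem_sdiff.2 ⟨hbj, (Finset.mem_sdiff.1 hb).2⟩)
    rw [this]
  · exact l2 a ha b (Finset.mem_sdiff.2 ⟨(Finset.mem_sdiff.1 hb).1, hbj⟩)

lemma phase2 {x y : V →ₗ[ℝ] ℝ} {X R : Finset V} {r : V} {k m m' : ℕ} (hk : 2 ≤ k)
    (S : Setup x y X R r k m m') (S' : Setup x y X R r k m' m) : False := by
  obtain ⟨Ab, hAb⟩ : ∃ Ab, Ab = X.filter (fun a => y r < y a) := ⟨_, rfl⟩
  obtain ⟨Be, hBe⟩ : ∃ Be, Be = X.filter (fun a => y a < y r) := ⟨_, rfl⟩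
  have mAb : ∀ a, a ∈ Ab ↔ a ∈ X ∧ y r < y a := fun a => by rw [hAb, Finset.mem_filter]
  have mBe : ∀ a, a ∈ Be ↔ a ∈ X ∧ y a < y r := fun a => by rw [hBe, Finset.mem_filter]
  have cBe : k ≤ Be.card := hBe ▸ S.hBe
  have cAb : k * m < Ab.card := hAb ▸ S.hAb
  have cAb' : k * m' < Ab.card := hAb ▸ S'.hAb
  have hAbX : Ab ⊆ X := fun a ha => ((mAb a).1 ha).1
  have hBeX : Be ⊆ X := fun a ha => ((mBe a).1 ha).1
  have hdAB : Disjoint Be Ab := by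
    rw [Finset.disjoint_left]
    intro a ha hb
    exact absurd ((mAb a).1 hb).2 (by linarith [((mBe a).1 ha).2])
  have csum : Be.card + 1 + Ab.card = k * m + k * m' + k := by
    have h1 : X = insert r Be ∪ Ab := by
      ext a
      simp only [Finset.mem_union, Finset.mem_insert, mAb, mBe]
      constructor
      · intro ha
        by_cases har : a = r
        · tauto
        · rcases lt_or_gt_of_ne (S.hy a ha har) with h | h <;> tauto
      · rintro ((rfl | h) | h)
        · exact S.rX
        · exact h.1
        · exact h.1
    have hrB : r ∉ Be := fun h => lt_irrefl _ ((mBe r).1 h).2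
    have hrA : r ∉ Ab := fun h => lt_irrefl _ ((mAb r).1 h).2
    have h2 := S.cardX
    rw [h1, Finset.card_union_of_disjoint (Finset.disjoint_insert_left.2 ⟨hrA, hdAB⟩),
      Finset.card_insert_of_notMem hrB] at h2
    rw [h2]; ring
  set φ := phi x y r 1 1 with hφ
  have hφ' : ∀ q, phi x y r (-1) 1 q = - φ q := fun q => by
    rw [hφ]; unfold phi; ring
  obtain ⟨L, Ls, Lc, Ll, Lm, Ln⟩ := chain Be φ (fun a ha b hb h =>
    phi_inj S.gp r S.rX 1 one_ne_zero a b (hBeX ha) (hBeX hb) ((mBe a).1 ha).2.ne ((mBe b).1 hb).2.ne h)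
  obtain ⟨T, Ts, Tc, Tl, Tm, -⟩ := chain Ab (fun a => - φ a) (fun a ha b hb h =>
    phi_inj S.gp r S.rX 1 one_ne_zero a b (hAbX ha) (hAbX hb) ((mAb a).1 ha).2.ne' ((mAb b).1 hb).2.ne'
      (neg_injective h))
  have Tl' : ∀ j ≤ Ab.card, ∀ a ∈ T j, ∀ b ∈ Ab \ T j, φ b ≤ φ a := fun j hj a ha b hb => by
    have := Tl j hj a ha b hb
    linarith
  obtain ⟨I, hI⟩ : ∃ I, I + k = Be.card + 1 := ⟨Be.card + 1 - k, by omega⟩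
  have hIm : I < k * m := by omega
  let NC3 : ℕ → Prop := fun i => ∃ a ∈ Ab \ T (k * m - i), ∃ b ∈ Be \ L (i + k - 1), φ b < φ a
  let NC2 : ℕ → Prop := fun i => ∃ a ∈ T (k * m - i), ∃ b ∈ L i, φ a < φ b
  let Y2 : ℕ → Finset V := fun i => T (k * m - i) ∪ L i
  let Z : ℕ → Finset V := fun i => L (i + k - 1) \ L i
  let Y3 : ℕ → Finset V := fun i => X \ (insert r (Z i) ∪ Y2 i)
  have sT : ∀ i, T (k * m - i) ⊆ Ab := fun i => Ts _ (by omega)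
  have sL : ∀ i ≤ I, L i ⊆ Be := fun i hi => Ls _ (by omega)
  have sLL : ∀ i ≤ I, L (i + k - 1) ⊆ Be := fun i hi => Ls _ (by omega)
  have sZ : ∀ i ≤ I, Z i ⊆ Be := fun i hi => Finset.sdiff_subset.trans (sLL i hi)
  have sLLL : ∀ i ≤ I, L i ⊆ L (i + k - 1) := fun i hi => Lm _ _ (by omega) (by omega)
  have Y2X : ∀ i ≤ I, Y2 i ⊆ X := fun i hi =>
    Finset.union_subset ((sT i).trans hAbX) ((sL i hi).trans hBeX)
  have hiY2 : ∀ i ≤ I, ∀ a ∈ Y2 i, y r < y a → a ∈ T (k * m - i) := by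
    intro i hi a ha h
    rcases Finset.mem_union.1 ha with ha | ha
    · exact ha
    · exact absurd ((mBe a).1 (sL i hi ha)).2 (by linarith)
  have loY2 : ∀ i ≤ I, ∀ a ∈ Y2 i, y a < y r → a ∈ L i := by
    intro i hi a ha h
    rcases Finset.mem_union.1 ha with ha | ha
    · exact absurd ((mAb a).1 (sT i ha)).2 (by linarith)
    · exact ha
  have hiY3 : ∀ i ≤ I, ∀ a ∈ Y3 i, y r < y a → a ∈ Ab \ T (k * m - i) := by
    intro i hi a ha h
    simp only [Y3, Y2, Finset.mem_sdiff, Finset.mem_union, Finset.mem_insert, not_or] at ha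
    simp only [Finset.mem_sdiff, mAb]
    tauto
  have loY3 : ∀ i ≤ I, ∀ a ∈ Y3 i, y a < y r → a ∈ Be \ L (i + k - 1) := by
    intro i hi a ha h
    simp only [Y3, Y2, Z, Finset.mem_sdiff, Finset.mem_union, Finset.mem_insert, not_or] at ha
    simp only [Finset.mem_sdiff, mBe]
    tauto
  have bZ : ∀ i ≤ I, ∀ z ∈ Z i, y z < y r := fun i hi z hz => ((mBe z).1 (sZ i hi hz)).2
  have rY2 : ∀ i ≤ I, r ∉ Y2 i := by
    intro i hi h
    rcases Finset.mem_union.1 h with h | h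
    · exact lt_irrefl _ ((mAb r).1 (sT i h)).2
    · exact lt_irrefl _ ((mBe r).1 (sL i hi h)).2
  have dZY : ∀ i ≤ I, Disjoint (Z i) (Y2 i) := by
    intro i hi
    refine Finset.disjoint_union_right.2 ⟨hdAB.mono (sZ i hi) (sT i), Finset.sdiff_disjoint⟩
  have cZ : ∀ i ≤ I, (Z i).card + 1 = k := by
    intro i hi
    simp only [Z]
    rw [Finset.card_sdiff_of_subset (sLLL i hi), Lc _ (by omega), Lc _ (by omega)]
    omega
  have cY2 : ∀ i ≤ I, (Y2 i).card = k * m := by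
    intro i hi
    simp only [Y2]
    rw [Finset.card_union_of_disjoint (hdAB.symm.mono (sT i) (sL i hi)), Tc _ (by omega),
      Lc _ (by omega)]
    omega
  have nogood : ∀ i ≤ I, ¬ NC3 i → ¬ NC2 i → (Y2 i ∩ R).card ≠ m := by
    intro i hi h3 h2 hred
    simp only [NC3, NC2] at h3 h2
    push Not at h3 h2
    refine S.tri_good 1 1 one_ne_zero le_rfl ((sZ i hi).trans hBeX) (bZ i hi) (Y2X i hi) (rY2 i hi)
      (dZY i hi) (cZ i hi) (cY2 i hi) hred ?_ (Y3 i) rfl ?_ ?_ ?_ ?_ ?_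
    · refine (cut_sep S.gp r S.hy 1 1 one_ne_zero le_rfl (Y2 i) (insert r (Z i)) (Y2X i hi)
        (Finset.insert_subset S.rX ((sZ i hi).trans hBeX))
        (Finset.disjoint_insert_right.2 ⟨rY2 i hi, (dZY i hi).symm⟩) (fun _ => rfl) ?_ ?_ ?_ ?_).symm
      · intro a ha b hb h h'
        exact h2 b (hiY2 i hi b hb h') a (loY2 i hi a ha h)
      · intro a ha b hb h h'
        have hb' : b ∈ Z i := by
          rcases Finset.mem_insert.1 hb with rfl | hb
          · exact absurd h' (lt_irrefl _)
          · exact hb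
        have hb2 := Finset.mem_sdiff.1 hb'
        exact Ll i (by omega) a (loY2 i hi a ha h) b
          (Finset.mem_sdiff.2 ⟨sLL i hi hb2.1, hb2.2⟩)
      · intro a ha b hb h h'
        rcases Finset.mem_insert.1 ha with rfl | ha
        · exact absurd h (lt_irrefl _)
        · exact absurd (bZ i hi a ha) (by linarith)
      · intro a ha b hb h h'
        rcases Finset.mem_insert.1 ha with rfl | ha
        · exact absurd h (lt_irrefl _)
        · exact absurd (bZ i hi a ha) (by linarith)
    · intro a ha b hb h
      exact Ll _ (by omega) a (Finset.mem_sdiff.1 ha).1 b (loY3 i hi b hb h)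
    · intro a ha b hb h h'
      exact h3 a (hiY3 i hi a ha h) b (loY3 i hi b hb h')
    · intro a ha b hb h h'
      exact h2 b (hiY2 i hi b hb h') a (loY2 i hi a ha h)
    · intro a ha b hb h h'
      exact Ll _ (by omega) a (sLLL i hi (loY2 i hi a ha h)) b (loY3 i hi b hb h')
    · intro a ha b hb h h'
      exact Tl' _ (by omega) b (hiY2 i hi b hb h') a (hiY3 i hi a ha h)
  have main : ∀ i ≤ I, NC3 i ∨ (¬ NC2 i ∧ m + 1 ≤ (Y2 i ∩ R).card) := by
    intro i
    induction i with
    | zero =>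
      intro _
      by_cases h3 : NC3 0
      · exact Or.inl h3
      right
      have L0 : L 0 = ∅ := Finset.card_eq_zero.1 (Lc 0 (by omega))
      refine ⟨?_, ?_⟩
      · rintro ⟨a, _, b, hb, _⟩
        rw [L0] at hb
        simp at hb
      · simp only [NC3] at h3
        push Not at h3
        simp only [Nat.sub_zero, Nat.zero_add] at h3
        have := S.phase1 1 one_ne_zero Ab Be hAb hBe (T (k * m)) (L (k - 1)) (Ts _ (by omega))
          (Ls _ (by omega)) (Tc _ (by omega)) (by rw [Lc _ (by omega)]; omega)
          (Tl' _ (by omega)) (Ll _ (by omega)) h3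
        simpa only [Y2, Nat.sub_zero, L0, Finset.union_empty] using this
    | succ i ih =>
      intro hi1
      have hi : i ≤ I := by omega
      have ih := ih hi
      have mT : T (k * m - (i + 1)) ⊆ T (k * m - i) := Tm _ _ (by omega) (by omega)
      by_contra hcon
      push Not at hcon
      obtain ⟨hn3, hcon⟩ := hcon
      by_cases h2 : NC2 (i + 1)
      · obtain ⟨a', ha', b', hb', hab'⟩ := h2
        rcases ih with ⟨a, ha, b, hb, hab⟩ | ⟨h2, hred⟩
        · have e1 := Tl' _ (by omega) a' (mT ha') a ha
          have e2 := Ll (i + k - 1) (by omega) b' (Lm (i + 1) (i + k - 1) (by omega) (by omega) hb') b hb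
          linarith
        · simp only [NC2] at h2
          push Not at h2
          have hh := cut_half (x := x) (X := X) r S.hy 1 1 one_ne_zero le_rfl (Y2 i) (X \ Y2 i)
            (Finset.union_sdiff_of_subset (Y2X i hi)) Finset.disjoint_sdiff S.exists_ne (fun _ => rfl)
            (fun a ha b hb h h' => h2 b (hiY2 i hi b hb h') a (loY2 i hi a ha h))
            (fun a ha b hb h h' => Ll i (by omega) a (loY2 i hi a ha h) b (by
              simp only [Y2, Finset.mem_sdiff, Finset.mem_union, mBe] at hb ⊢; tauto))
            (fun a ha b hb h h' => Tl' _ (by omega) b (hiY2 i hi b hb h') a (by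
              simp only [Y2, Finset.mem_sdiff, Finset.mem_union, mAb] at ha ⊢; tauto))
            (fun a ha b hb h h' => by
              have e1 := Tl' _ (by omega) a' (mT ha') a (by
                simp only [Y2, Finset.mem_sdiff, Finset.mem_union, mAb] at ha ⊢; tauto)
              have e2 := Ln i (by omega) b' hb' b (by
                simp only [Y2, Finset.mem_sdiff, Finset.mem_union, mBe] at hb ⊢; tauto)
              have : φ a ≤ φ b := by linarith
              exact this)
          have := S'.hhalf _ hh.2 (cY2 i hi)
          omega
      · have hred := hcon h2
        have hne := nogood (i + 1) hi1 hn3 h2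
        rcases ih with ⟨a', ha', b', hb', hab'⟩ | ⟨-, hred'⟩
        · simp only [NC3] at hn3
          push Not at hn3
          have hlow : ∀ a ∈ Z (i + 1) ∪ Y2 (i + 1), y a < y r → a ∈ L (i + 1 + k - 1) := by
            intro a ha h
            rcases Finset.mem_union.1 ha with ha | ha
            · exact (Finset.mem_sdiff.1 ha).1
            · exact sLLL _ hi1 (loY2 _ hi1 a ha h)
          have := S.tri_half 1 1 one_ne_zero le_rfl ((sZ _ hi1).trans hBeX) (bZ _ hi1) (Y2X _ hi1)
            (rY2 _ hi1) (dZY _ hi1) (cZ _ hi1) (cY2 _ hi1) (Y3 (i + 1)) rfl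
            (fun a ha b hb h h' => by
              have e1 := Ln (i + k - 1) (by omega) a (by
                have := hlow a ha h
                rwa [show i + 1 + k - 1 = i + k - 1 + 1 by omega] at this) b' hb'
              have e2 := Tl' _ (by omega) b (mT (hiY2 _ hi1 b hb h')) a' ha'
              have : φ a ≤ φ b := by linarith
              exact this)
            (fun a ha b hb h h' => Ll _ (by omega) a (hlow a ha h) b (loY3 _ hi1 b hb h'))
            (fun a ha b hb h h' => Tl' _ (by omega) b (hiY2 _ hi1 b hb h') a (hiY3 _ hi1 a ha h))
            (fun a ha b hb h h' => hn3 a (hiY3 _ hi1 a ha h) b (loY3 _ hi1 b hb h'))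
          omega
        · have hsub : Y2 i ∩ R ⊆ (Y2 (i + 1) ∩ R) ∪ (T (k * m - i) \ T (k * m - (i + 1))) := by
            have := Lm i (i + 1) (by omega) (by omega)
            intro a ha
            simp only [Y2, Finset.mem_inter, Finset.mem_union, Finset.mem_sdiff] at ha ⊢
            have := @this a
            tauto
          have h1 := (Finset.card_le_card hsub).trans (Finset.card_union_le _ _)
          rw [Finset.card_sdiff_of_subset mT, Tc _ (by omega), Tc _ (by omega)] at h1
          omega
  have hLI : L (I + k - 1) = Be :=
    Finset.eq_of_subset_of_card_le (sLL I le_rfl) (by rw [Lc _ (by omega)]; omega)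
  rcases main I le_rfl with ⟨a, ha, b, hb, hab⟩ | ⟨h2, hred⟩
  · rw [hLI] at hb
    simp at hb
  · simp only [NC2] at h2
    push Not at h2
    have e1 : Ab \ (Ab \ T (k * m - I)) = T (k * m - I) := Finset.sdiff_sdiff_eq_self (sT I)
    have e2 : Be \ (Be \ L I) = L I := Finset.sdiff_sdiff_eq_self (sL I le_rfl)
    have := S'.phase1 (-1) (by norm_num) Ab Be hAb hBe (Ab \ T (k * m - I)) (Be \ L I)
      Finset.sdiff_subset Finset.sdiff_subset
      (by rw [Finset.card_sdiff_of_subset (sT I), Tc _ (by omega)]; omega)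
      (by rw [Finset.card_sdiff_of_subset (sL I le_rfl), Lc _ (by omega)]; omega)
      (by
        intro a ha b hb
        rw [e1] at hb
        rw [hφ', hφ']
        exact neg_le_neg (Tl' _ (by omega) b hb a ha))
      (by
        intro a ha b hb
        rw [e2] at hb
        rw [hφ', hφ']
        exact neg_le_neg (Ll _ (by omega) b hb a ha))
      (by
        intro a ha b hb
        rw [e1] at ha
        rw [e2] at hb
        rw [hφ', hφ']
        exact neg_le_neg (h2 a ha b hb))
    have c := (S.counts ((sZ I le_rfl).trans hBeX) (bZ I le_rfl) (Y2X I le_rfl) (rY2 I le_rfl)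
      (dZY I le_rfl) (cZ I le_rfl) (cY2 I le_rfl)).2
    have hsub : (Ab \ T (k * m - I)) ∩ R ⊆ (X \ (insert r (Z I) ∪ Y2 I)) ∩ R := by
      intro a ha
      simp only [Finset.mem_inter, Finset.mem_sdiff, Finset.mem_union, Finset.mem_insert, Y2, not_or] at ha ⊢
      obtain ⟨⟨ha1, ha2⟩, ha3⟩ := ha
      have hya := ((mAb a).1 ha1).2
      refine ⟨⟨hAbX ha1, ⟨?_, ?_⟩, ha2, ?_⟩, ha3⟩
      · rintro rfl; exact lt_irrefl _ hya
      · intro h; exact absurd (bZ I le_rfl a h) (by linarith)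
      · intro h; exact absurd ((mBe a).1 (sL I le_rfl h)).2 (by linarith)
    have := Finset.card_le_card hsub
    omega

/-- a family of `n` subsets of size `k` with property `P` and pairwise disjoint hulls -/
def Fam (P : Finset V → Prop) (X : Finset V) (k n : ℕ) : Prop :=
  ∃ F : Finset (Finset V), F.card = n ∧ (∀ Y ∈ F, Y ⊆ X ∧ Y.card = k ∧ P Y) ∧
    ∀ Y ∈ F, ∀ Y' ∈ F, Y ≠ Y' →
      Disjoint (convexHull ℝ (Y : Set V)) (convexHull ℝ (Y' : Set V))

lemma Fam.combine {P : Finset V → Prop} {X X1 X2 : Finset V} {k n1 n2 : ℕ} (hk : 0 < k)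
    (h1 : Fam P X1 k n1) (h2 : Fam P X2 k n2) (s1 : X1 ⊆ X) (s2 : X2 ⊆ X)
    (hd : Disjoint (convexHull ℝ (X1 : Set V)) (convexHull ℝ (X2 : Set V))) :
    Fam P X k (n1 + n2) := by
  obtain ⟨F1, c1, p1, d1⟩ := h1
  obtain ⟨F2, c2, p2, d2⟩ := h2
  have key : ∀ Y ∈ F1, ∀ Y' ∈ F2,
      Disjoint (convexHull ℝ (Y : Set V)) (convexHull ℝ (Y' : Set V)) := fun Y hY Y' hY' =>
    hd.mono (convexHull_mono (Finset.coe_subset.2 (p1 Y hY).1))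
      (convexHull_mono (Finset.coe_subset.2 (p2 Y' hY').1))
  have hF : Disjoint F1 F2 := by
    rw [Finset.disjoint_left]
    intro Y hY hY'
    have h := key Y hY Y hY'
    rw [disjoint_self] at h
    obtain ⟨a, ha⟩ := Finset.card_pos.1 (by rw [(p1 Y hY).2.1]; exact hk : 0 < Y.card)
    have : a ∈ convexHull ℝ (Y : Set V) := subset_convexHull ℝ _ ha
    rw [h] at this
    exact this
  refine ⟨F1 ∪ F2, by rw [Finset.card_union_of_disjoint hF, c1, c2], ?_, ?_⟩
  · intro Y hY
    rcases Finset.mem_union.1 hY with h | h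
    · exact ⟨(p1 Y h).1.trans s1, (p1 Y h).2⟩
    · exact ⟨(p2 Y h).1.trans s2, (p2 Y h).2⟩
  · intro Y hY Y' hY' hne
    rcases Finset.mem_union.1 hY with h | h <;> rcases Finset.mem_union.1 hY' with h' | h'
    · exact d1 Y h Y' h' hne
    · exact key Y h Y' h'
    · exact (key Y' h' Y h).symm
    · exact d2 Y h Y' h' hne

lemma compl_counts {X Y R : Finset V} (h : Y ⊆ X) :
    (X \ Y).card + Y.card = X.card ∧ ((X \ Y) ∩ R).card + (Y ∩ R).card = (X ∩ R).card := by
  refine ⟨Finset.card_sdiff_add_card_eq_card h, ?_⟩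
  rw [← Finset.card_union_of_disjoint]
  · congr 1
    ext a
    have := @h a
    simp only [Finset.mem_union, Finset.mem_inter, Finset.mem_sdiff]
    tauto
  · exact Finset.sdiff_disjoint.mono Finset.inter_subset_left Finset.inter_subset_left

lemma Be_bound {y : V →ₗ[ℝ] ℝ} {X R L : Finset V} {r : V} (hrX : r ∈ X) (hLX : L ⊆ X)
    (low : ∀ q ∈ X ∩ R, q ≠ r → y r < y q)
    (hl : ∀ a ∈ L, ∀ b ∈ X \ L, y a ≤ y b) (h2 : 2 ≤ (L ∩ R).card) :
    (X.filter (fun a => y a < y r)).card + 2 ≤ L.card := by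
  obtain ⟨q, hq, hqr⟩ := Finset.exists_mem_ne (by omega : 1 < (L ∩ R).card) r
  have hqL := (Finset.mem_inter.1 hq).1
  have hy := low q (Finset.mem_inter.2 ⟨hLX hqL, (Finset.mem_inter.1 hq).2⟩) hqr
  have e : (insert q (insert r (X.filter (fun a => y a < y r)))).card
      = (X.filter (fun a => y a < y r)).card + 2 := by
    rw [Finset.card_insert_of_notMem, Finset.card_insert_of_notMem]
    · simp
    · simp only [Finset.mem_insert, Finset.mem_filter, not_or, not_and, not_lt]
      exact ⟨hqr, fun _ => hy.le⟩
  rw [← e]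
  refine Finset.card_le_card ?_
  have : ∀ p ∈ X, y p ≤ y r → p ∈ L := by
    intro p hp hpr
    by_contra hn
    have := hl q hqL p (Finset.mem_sdiff.2 ⟨hp, hn⟩)
    linarith
  intro p hp
  simp only [Finset.mem_insert, Finset.mem_filter] at hp
  rcases hp with rfl | rfl | ⟨h1, h2⟩
  · exact hqL
  · exact this _ hrX le_rfl
  · exact this p h1 h2.le

theorem exact_thm {x y : V →ₗ[ℝ] ℝ} (R : Finset V) (k : ℕ) (hk : 2 ≤ k) (n : ℕ) :
    ∀ X : Finset V, GP x y X → (∀ a ∈ X, ∀ b ∈ X, y a = y b → a = b) → X.card = k * n →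
      (X ∩ R).card = n → Fam (fun Y => (Y ∩ R).card = 1) X k n := by
  induction n using Nat.strong_induction_on with
  | _ n ih =>
  intro X gp hinj hX hR
  rcases Nat.lt_or_ge n 2 with hn | hn
  · interval_cases n
    · exact ⟨∅, by simp, by simp, by simp⟩
    · refine ⟨{X}, by simp, ?_, ?_⟩
      · intro Y hY
        rw [Finset.mem_singleton] at hY
        subst hY
        exact ⟨subset_rfl, by omega, hR⟩
      · intro Y hY Y' hY' hne
        rw [Finset.mem_singleton] at hY hY'
        exact absurd (hY.trans hY'.symm) hne
  by_contra hneg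
  have recn : ∀ m < n, ∀ Y ⊆ X, Y.card = k * m → (Y ∩ R).card = m →
      Fam (fun Y => (Y ∩ R).card = 1) Y k m := by
    intro m hm Y hY h1 h2
    exact ih m hm Y (gp.mono hY) (fun a ha b hb => hinj a (hY ha) b (hY hb)) h1 h2
  have hmul : ∀ m ≤ n, k * m ≤ X.card := fun m hm => by rw [hX]; exact Nat.mul_le_mul_left k hm
  have hcm : ∀ m ≤ n, k * (n - m) + k * m = k * n := fun m hm => by
    rw [← Nat.mul_add, Nat.sub_add_cancel hm]
  have hsplit : ∀ m, 1 ≤ m → m < n → ∀ Y, IsHalf x y X Y → Y.card = k * m → (Y ∩ R).card ≠ m := by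
    intro m hm1 hmn Y hY hYc hYR
    obtain ⟨e1, e2⟩ := compl_counts (R := R) hY.1
    have := hcm m hmn.le
    have := Fam.combine (by omega) (recn m hmn Y hY.1 hYc hYR)
      (recn (n - m) (by omega) (X \ Y) Finset.sdiff_subset (by omega) (by omega))
      hY.1 Finset.sdiff_subset (hY.disj gp)
    rw [Nat.add_sub_cancel' hmn.le] at this
    exact hneg this
  have hsgn : ∀ m, 1 ≤ m → m < n →
      (∀ Y, IsHalf x y X Y → Y.card = k * m → (Y ∩ R).card < m) ∨
      (∀ Y, IsHalf x y X Y → Y.card = k * m → m < (Y ∩ R).card) := fun m h1 h2 =>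
    half_ivt gp R (k * m) m (hmul m h2.le) (hsplit m h1 h2)
  obtain ⟨L, Ls, Lc, Ll, Lm, -⟩ := chain X (fun a => y a) hinj
  have Lh : ∀ j ≤ X.card, IsHalf x y X (L j) := fun j hj =>
    ⟨Ls j hj, 0, 1, Or.inr one_ne_zero, fun a ha b hb => by simpa using Ll j hj a ha b hb⟩
  have hp1 : ∀ Y, IsHalf x y X Y → Y.card = k * 1 → (Y ∩ R).card < 1 := by
    rcases hsgn 1 le_rfl (by omega) with h | h
    · exact h
    exfalso
    have all : ∀ m, 1 ≤ m → m < n → m < (L (k * m) ∩ R).card := by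
      intro m hm
      induction m, hm using Nat.le_induction with
      | base => exact fun h1 => h _ (Lh _ (hmul 1 (by omega))) (Lc _ (hmul 1 (by omega)))
      | succ m hm ih2 =>
        intro hmn
        rcases hsgn (m + 1) (by omega) hmn with h' | h'
        · have a1 := h' _ (Lh _ (hmul _ hmn.le)) (Lc _ (hmul _ hmn.le))
          have a2 := ih2 (by omega)
          have a3 : (L (k * m) ∩ R).card ≤ (L (k * (m + 1)) ∩ R).card :=
            Finset.card_le_card (Finset.inter_subset_inter_right
              (Lm _ _ (Nat.mul_le_mul_left k (by omega)) (hmul _ hmn.le)))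
          omega
        · exact h' _ (Lh _ (hmul _ hmn.le)) (Lc _ (hmul _ hmn.le))
    have b1 := all (n - 1) (by omega) (by omega)
    have hh := Lh _ (hmul (n - 1) (by omega))
    obtain ⟨e1, e2⟩ := compl_counts (R := R) hh.1
    have b2 := Lc _ (hmul (n - 1) (by omega))
    have b3 := hcm (n - 1) (by omega)
    rw [show n - (n - 1) = 1 by omega] at b3
    have := h _ hh.compl (by omega)
    omega
  have hex : ∃ m, 1 ≤ m ∧ m < n ∧ (∀ Y, IsHalf x y X Y → Y.card = k * m → m < (Y ∩ R).card) := by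
    refine ⟨n - 1, by omega, by omega, ?_⟩
    rcases hsgn (n - 1) (by omega) (by omega) with h | h
    · exfalso
      have hh := Lh _ (hmul (n - 1) (by omega))
      obtain ⟨e1, e2⟩ := compl_counts (R := R) hh.1
      have b2 := Lc _ (hmul (n - 1) (by omega))
      have b3 := hcm (n - 1) (by omega)
      rw [show n - (n - 1) = 1 by omega] at b3
      have := hp1 _ hh.compl (by omega)
      have := h _ hh b2
      omega
    · exact h
  classical
  obtain ⟨M1, Mn, hM⟩ := Nat.find_spec hex
  have hmin := fun m => Nat.find_min (H := hex) (m := m)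
  generalize Nat.find hex = M at M1 Mn hM hmin
  have hM2 : 2 ≤ M := by
    by_contra hlt
    have : M = 1 := by omega
    subst this
    have a := hp1 _ (Lh _ (hmul 1 (by omega))) (Lc _ (hmul 1 (by omega)))
    have b := hM _ (Lh _ (hmul 1 (by omega))) (Lc _ (hmul 1 (by omega)))
    omega
  obtain ⟨m, rfl⟩ : ∃ m, M = m + 1 := ⟨M - 1, by omega⟩
  have hplus : ∀ Y, IsHalf x y X Y → Y.card = k * m → (Y ∩ R).card < m := by
    rcases hsgn m (by omega) (by omega) with h | h
    · exact h
    · exact absurd ⟨by omega, by omega, h⟩ (hmin m (by omega))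
  obtain ⟨m', rfl⟩ : ∃ m', n = m + m' + 1 := ⟨n - m - 1, by omega⟩
  have em : k * (m + m' + 1) = k * m + k * m' + k := by ring
  have em1 : k * (m + 1) = k * m + k := by ring
  have em2 : k * (m' + 1) = k * m' + k := by ring
  have hplus' : ∀ Y, IsHalf x y X Y → Y.card = k * m' → (Y ∩ R).card < m' := by
    intro Y hY hc
    obtain ⟨e1, e2⟩ := compl_counts (R := R) hY.1
    have := hM _ hY.compl (by omega)
    omega
  have hminus' : ∀ Y, IsHalf x y X Y → Y.card = k * (m' + 1) → m' + 1 < (Y ∩ R).card := by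
    intro Y hY hc
    obtain ⟨e1, e2⟩ := compl_counts (R := R) hY.1
    have := hplus _ hY.compl (by omega)
    omega
  have hinter : ∀ Y ⊆ X, Y ∩ (X ∩ R) = Y ∩ R := fun Y hY => by
    rw [← Finset.inter_assoc, Finset.inter_eq_left.2 hY]
  obtain ⟨r, hr, hrmin⟩ := (X ∩ R).exists_min_image (fun a => y a)
    (Finset.card_pos.1 (by omega))
  have hrX := (Finset.mem_inter.1 hr).1
  have low : ∀ q ∈ X ∩ R, q ≠ r → y r < y q := fun q hq hne =>
    lt_of_le_of_ne (hrmin q hq) (fun h => hne (hinj r hrX q (Finset.mem_inter.1 hq).1 h).symm)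
  have hBe : k ≤ (X.filter (fun a => y a < y r)).card := by
    have h1 := hmul 1 (by omega)
    have a := hp1 _ (Lh _ h1) (Lc _ h1)
    have c := Lc _ h1
    rw [mul_one] at *
    have a0 : L k ∩ R = ∅ := Finset.card_eq_zero.1 (by omega)
    have hrL : r ∉ L k := fun h => by
      have : r ∈ L k ∩ R := Finset.mem_inter.2 ⟨h, (Finset.mem_inter.1 hr).2⟩
      rw [a0] at this
      simp at this
    calc k = (L k).card := c.symm
      _ ≤ _ := Finset.card_le_card (fun p hp => by
        refine Finset.mem_filter.2 ⟨Ls _ h1 hp, ?_⟩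
        have := Ll _ h1 p hp r (Finset.mem_sdiff.2 ⟨hrX, hrL⟩)
        exact lt_of_le_of_ne this (fun h => hrL (hinj p (Ls _ h1 hp) r hrX h ▸ hp)))
  have hsum : (X.filter (fun a => y a < y r)).card + (X.filter (fun a => y r < y a)).card + 1
      = X.card := by
    have e1 := Finset.card_filter_add_card_filter_not (s := X) (fun a => y a < y r)
    have e2 : X.filter (fun a => ¬ y a < y r) = insert r (X.filter (fun a => y r < y a)) := by
      ext p
      simp only [Finset.mem_filter, Finset.mem_insert, not_lt]
      constructor
      · rintro ⟨h1, h2⟩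
        by_cases hpr : p = r
        · exact Or.inl hpr
        · exact Or.inr ⟨h1, lt_of_le_of_ne h2 (fun h => hpr (hinj r hrX p h1 h).symm)⟩
      · rintro (rfl | ⟨h1, h2⟩)
        · exact ⟨hrX, le_rfl⟩
        · exact ⟨h1, h2.le⟩
    rw [e2, Finset.card_insert_of_notMem (by simp)] at e1
    omega
  have hB1 : (X.filter (fun a => y a < y r)).card + 2 ≤ k * (m + 1) := by
    have h1 := hmul (m + 1) (by omega)
    have := hM _ (Lh _ h1) (Lc _ h1)
    have := Be_bound hrX (Ls _ h1) low (Ll _ h1) (by omega)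
    rwa [Lc _ h1] at this
  have hB2 : (X.filter (fun a => y a < y r)).card + 2 ≤ k * (m' + 1) := by
    have h1 := hmul (m' + 1) (by omega)
    have := hminus' _ (Lh _ h1) (Lc _ h1)
    have := Be_bound hrX (Ls _ h1) low (Ll _ h1) (by omega)
    rwa [Lc _ h1] at this
  have hm'1 : 1 ≤ m' := by omega
  have ng : NoTri X (X ∩ R) k m m' := by
    intro Y1 Y2 Y3 hu h12 h13 h23 c1 c2 c3 r1 r2 r3 d12 d13 d23
    have s1 : Y1 ⊆ X := by
      rw [← hu]; exact fun a ha => Finset.mem_union_left _ (Finset.mem_union_left _ ha)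
    have s2 : Y2 ⊆ X := by
      rw [← hu]; exact fun a ha => Finset.mem_union_left _ (Finset.mem_union_right _ ha)
    have s3 : Y3 ⊆ X := by
      rw [← hu]; exact fun a ha => Finset.mem_union_right _ ha
    rw [hinter _ s1] at r1
    rw [hinter _ s2] at r2
    rw [hinter _ s3] at r3
    obtain ⟨F1, f1, p1, q1⟩ := recn 1 (by omega) Y1 s1 (by omega) r1
    obtain ⟨F2, f2, p2, q2⟩ := recn m (by omega) Y2 s2 c2 r2
    obtain ⟨F3, f3, p3, q3⟩ := recn m' (by omega) Y3 s3 c3 r3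
    apply hneg
    have key : ∀ {F F' : Finset (Finset V)} {Z Z' : Finset V},
        (∀ Y ∈ F, Y ⊆ Z ∧ Y.card = k ∧ (Y ∩ R).card = 1) →
        (∀ Y ∈ F', Y ⊆ Z' ∧ Y.card = k ∧ (Y ∩ R).card = 1) →
        Disjoint (convexHull ℝ (Z : Set V)) (convexHull ℝ (Z' : Set V)) →
        ∀ Y ∈ F, ∀ Y' ∈ F', Disjoint (convexHull ℝ (Y : Set V)) (convexHull ℝ (Y' : Set V)) :=
      fun p p' d Y hY Y' hY' => d.mono (convexHull_mono (Finset.coe_subset.2 (p Y hY).1))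
        (convexHull_mono (Finset.coe_subset.2 (p' Y' hY').1))
    have dj : ∀ {F F' : Finset (Finset V)} {Z Z' : Finset V},
        (∀ Y ∈ F, Y ⊆ Z ∧ Y.card = k ∧ (Y ∩ R).card = 1) →
        (∀ Y ∈ F', Y ⊆ Z' ∧ Y.card = k ∧ (Y ∩ R).card = 1) →
        Disjoint Z Z' → Disjoint F F' := fun p p' d => by
      rw [Finset.disjoint_left]
      intro Y hY hY'
      obtain ⟨a, ha⟩ := Finset.card_pos.1 (by rw [(p Y hY).2.1]; omega : 0 < Y.card)
      exact Finset.disjoint_left.1 d ((p Y hY).1 ha) ((p' Y hY').1 ha)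
    refine ⟨F1 ∪ F2 ∪ F3, ?_, ?_, ?_⟩
    · rw [Finset.card_union_of_disjoint, Finset.card_union_of_disjoint (dj p1 p2 h12)]
      · omega
      · exact Finset.disjoint_union_left.2 ⟨dj p1 p3 h13, dj p2 p3 h23⟩
    · intro Y hY
      simp only [Finset.mem_union] at hY
      rcases hY with (h | h) | h
      · exact ⟨(p1 Y h).1.trans s1, (p1 Y h).2⟩
      · exact ⟨(p2 Y h).1.trans s2, (p2 Y h).2⟩
      · exact ⟨(p3 Y h).1.trans s3, (p3 Y h).2⟩
    · intro Y hY Y' hY' hne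
      simp only [Finset.mem_union] at hY hY'
      rcases hY with (h | h) | h <;> rcases hY' with (h' | h') | h'
      · exact q1 Y h Y' h' hne
      · exact key p1 p2 d12 Y h Y' h'
      · exact key p1 p3 d13 Y h Y' h'
      · exact (key p1 p2 d12 Y' h' Y h).symm
      · exact q2 Y h Y' h' hne
      · exact key p2 p3 d23 Y h Y' h'
      · exact (key p1 p3 d13 Y' h' Y h).symm
      · exact (key p2 p3 d23 Y' h' Y h).symm
      · exact q3 Y h Y' h' hne
  have hy : ∀ q ∈ X, q ≠ r → y q ≠ y r := fun q hq hne h => hne (hinj q hq r hrX h)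
  refine phase2 (x := x) (y := y) (X := X) (R := X ∩ R) (r := r) (m := m) (m' := m') hk
    ⟨gp, hrX, hr, Finset.inter_subset_left, hy, low, hX, hR, hBe, by omega, ?_, ng⟩
    ⟨gp, hrX, hr, Finset.inter_subset_left, hy, low, by rw [hX]; ring, by omega, hBe, by omega, ?_,
      ng.swap⟩
  · intro Y hY hc
    rw [hinter _ hY.1]
    exact hplus' Y hY hc
  · intro Y hY hc
    rw [hinter _ hY.1]
    exact hplus Y hY hc

/-- both colours are present -/
def Two (A B : Finset V) (Y : Finset V) : Prop := 1 ≤ (Y ∩ A).card ∧ 1 ≤ (Y ∩ B).card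

lemma split_card {A B Y : Finset V} (hd : Disjoint A B) (h : Y ⊆ A ∪ B) :
    (Y ∩ A).card + (Y ∩ B).card = Y.card := by
  rw [← Finset.card_union_of_disjoint
    (hd.mono Finset.inter_subset_right Finset.inter_subset_right),
    ← Finset.inter_union_distrib_left, Finset.inter_eq_left.2 h]

lemma Fam.imp {P Q : Finset V → Prop} {X : Finset V} {k n : ℕ} (h : Fam P X k n)
    (hPQ : ∀ Y ⊆ X, Y.card = k → P Y → Q Y) : Fam Q X k n := by
  obtain ⟨F, c, p, d⟩ := h
  exact ⟨F, c, fun Y hY => ⟨(p Y hY).1, (p Y hY).2.1, hPQ Y (p Y hY).1 (p Y hY).2.1 (p Y hY).2.2⟩, d⟩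

lemma small_case {x y : V →ₗ[ℝ] ℝ} {A B X : Finset V} {k n : ℕ} (hk : 2 ≤ k)
    (gp : GP x y X) (hinj : ∀ a ∈ X, ∀ b ∈ X, y a = y b → a = b) (hX : X.card = k * n)
    (hd : Disjoint A B) (hs : X ⊆ A ∪ B)
    (hB : n ≤ (X ∩ B).card) (hB' : (X ∩ B).card + 2 ≤ n + k) : Fam (Two A B) X k n := by
  obtain ⟨R, hR, hRc⟩ := Finset.exists_subset_card_eq hB
  have hXR : X ∩ R = R := Finset.inter_eq_right.2 (hR.trans Finset.inter_subset_left)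
  refine (exact_thm R k hk n X gp hinj hX (by rw [hXR, hRc])).imp ?_
  intro Y hY hYc hYR
  have h1 := split_card hd (hY.trans hs)
  have h2 : (Y ∩ R).card ≤ (Y ∩ B).card :=
    Finset.card_le_card (Finset.inter_subset_inter_left (hR.trans Finset.inter_subset_right))
  have h3 : (Y ∩ B).card ≤ (Y ∩ R).card + ((X ∩ B) \ R).card := by
    refine (Finset.card_le_card (t := (Y ∩ R) ∪ ((X ∩ B) \ R)) ?_).trans (Finset.card_union_le _ _)
    intro a ha
    have := @hY a
    simp only [Finset.mem_inter, Finset.mem_union, Finset.mem_sdiff] at ha ⊢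
    tauto
  rw [Finset.card_sdiff_of_subset hR] at h3
  exact ⟨by omega, by omega⟩

lemma mono_case {x y : V →ₗ[ℝ] ℝ} {A B X : Finset V} {k n : ℕ} (hk : 2 ≤ k) (hn : 2 ≤ n)
    (gp : GP x y X) (hinj : ∀ a ∈ X, ∀ b ∈ X, y a = y b → a = b) (hX : X.card = k * n)
    (hd : Disjoint A B) (hs : X ⊆ A ∪ B)
    (hA : n + k ≤ (X ∩ A).card + 1) (hB : n + k ≤ (X ∩ B).card + 1)
    (hgood : ∀ m, 1 ≤ m → m < n → ∀ Y, IsHalf x y X Y → Y.card = k * m →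
      m ≤ (Y ∩ A).card → m ≤ (Y ∩ B).card → n - m ≤ ((X \ Y) ∩ A).card →
      n - m ≤ ((X \ Y) ∩ B).card → False)
    (hmono : ∀ Y, IsHalf x y X Y → Y.card = k → (Y ∩ B).card < 1) : False := by
  obtain ⟨L, Ls, Lc, Ll, Lm, -⟩ := chain X (fun a => y a) hinj
  have Lh : ∀ j ≤ X.card, IsHalf x y X (L j) := fun j hj =>
    ⟨Ls j hj, 0, 1, Or.inr one_ne_zero, fun a ha b hb => by simpa using Ll j hj a ha b hb⟩
  have hmul : ∀ m ≤ n, k * m ≤ X.card := fun m hm => by rw [hX]; exact Nat.mul_le_mul_left k hm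
  have hXs := split_card hd hs
  have all : ∀ m, 1 ≤ m → m < n → (L (k * m) ∩ B).card < m ∨
      (L (k * m) ∩ B).card + k * n + m < (X ∩ B).card + n + k * m := by
    intro m hm
    induction m, hm using Nat.le_induction with
    | base =>
      intro _
      left
      rw [mul_one]
      have h1 := hmul 1 (by omega)
      rw [mul_one] at h1
      exact hmono _ (Lh _ h1) (Lc _ h1)
    | succ m hm ih2 =>
      intro hmn
      have i := ih2 (by omega)
      by_contra hcon
      have h0 := hmul m (by omega)
      have h1 := hmul (m + 1) (by omega)
      have hsub := Lm (k * m) (k * (m + 1)) (Nat.mul_le_mul_left k (by omega)) h1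
      have c0 := Lc _ h0
      have c1 := Lc _ h1
      have inc : (L (k * (m + 1)) ∩ B).card ≤ (L (k * m) ∩ B).card + k := by
        obtain ⟨e1, e2⟩ := compl_counts (R := B) hsub
        have : ((L (k * (m + 1)) \ L (k * m)) ∩ B).card ≤ (L (k * (m + 1)) \ L (k * m)).card :=
          Finset.card_le_card Finset.inter_subset_left
        have : k * (m + 1) = k * m + k := by ring
        omega
      have g := hgood (m + 1) (by omega) hmn _ (Lh _ h1) c1
      have e0 := split_card hd ((Ls _ h1).trans hs)
      obtain ⟨e1, e2⟩ := compl_counts (R := B) (Ls _ h1)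
      obtain ⟨-, e3⟩ := compl_counts (R := A) (Ls _ h1)
      have e1' := hX
      generalize (L (k * (m + 1)) ∩ B).card = β' at *
      generalize (L (k * (m + 1)) ∩ A).card = α' at *
      generalize ((X \ L (k * (m + 1))) ∩ B).card = β'' at *
      generalize ((X \ L (k * (m + 1))) ∩ A).card = α'' at *
      generalize (L (k * m) ∩ B).card = β at *
      rw [c1] at e0
      clear c0 c1 e1 hmul hsub h0 h1 ih2 hmono hgood Lh Lm Ll Lc Ls
      obtain ⟨d, rfl⟩ : ∃ d, n = m + 2 + d := ⟨n - m - 2, by omega⟩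
      obtain ⟨K, rfl⟩ : ∃ K, k = K + 2 := ⟨k - 2, by omega⟩
      have q1 : (K + 2) * (m + 1) = K * m + 2 * m + K + 2 := by ring
      have q2 : (K + 2) * m = K * m + 2 * m := by ring
      have q3 : (K + 2) * (m + 2 + d) = K * m + 2 * m + 2 * K + 4 + K * d + 2 * d := by ring
      rw [q1] at e0 hcon
      rw [q2] at i
      rw [q3] at i hcon e1'
      generalize K * m = u at *
      generalize K * d = w at *
      by_cases f1 : m + 1 ≤ α'
      · by_cases f2 : m + 2 + d - (m + 1) ≤ β''
        · exact g f1 (by omega) (by omega) f2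
        · omega
      · omega
  have hlast := all (n - 1) (by omega) (by omega)
  have h1 := hmul (n - 1) (by omega)
  have hh := Lh _ h1
  obtain ⟨e1, e2⟩ := compl_counts (R := B) hh.1
  have c := Lc _ h1
  obtain ⟨d, rfl⟩ : ∃ d, n = d + 1 := ⟨n - 1, by omega⟩
  simp only [Nat.add_sub_cancel] at *
  have q : k * (d + 1) = k * d + k := by ring
  have := hmono _ hh.compl (by omega)
  omega

theorem two_thm {x y : V →ₗ[ℝ] ℝ} (A B : Finset V) (hd : Disjoint A B) (k : ℕ) (hk : 2 ≤ k)
    (n : ℕ) : ∀ X : Finset V, GP x y X → (∀ a ∈ X, ∀ b ∈ X, y a = y b → a = b) →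
      X.card = k * n → X ⊆ A ∪ B → n ≤ (X ∩ A).card → n ≤ (X ∩ B).card →
      Fam (Two A B) X k n := by
  induction n using Nat.strong_induction_on with
  | _ n ih =>
  intro X gp hinj hX hs hA hB
  by_cases hB' : (X ∩ B).card + 2 ≤ n + k
  · exact small_case hk gp hinj hX hd hs hB hB'
  by_cases hA' : (X ∩ A).card + 2 ≤ n + k
  · exact (small_case hk gp hinj hX hd.symm (by rwa [Finset.union_comm]) hA hA').imp
      (fun Y _ _ h => ⟨h.2, h.1⟩)
  have hXs := split_card hd hs
  have hn : 2 ≤ n := by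
    by_contra hlt
    have : n = 0 ∨ n = 1 := by omega
    rcases this with rfl | rfl <;> omega
  by_contra hneg
  have hgood : ∀ m, 1 ≤ m → m < n → ∀ Y, IsHalf x y X Y → Y.card = k * m →
      m ≤ (Y ∩ A).card → m ≤ (Y ∩ B).card → n - m ≤ ((X \ Y) ∩ A).card →
      n - m ≤ ((X \ Y) ∩ B).card → False := by
    intro m hm1 hmn Y hY hc h1 h2 h3 h4
    obtain ⟨e1, e2⟩ := compl_counts (R := B) hY.1
    have e : k * (n - m) + k * m = k * n := by rw [← Nat.mul_add, Nat.sub_add_cancel hmn.le]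
    have s2 : X \ Y ⊆ X := Finset.sdiff_subset
    have := Fam.combine (by omega)
      (ih m hmn Y (gp.mono hY.1) (fun a ha b hb => hinj a (hY.1 ha) b (hY.1 hb)) hc
        (hY.1.trans hs) h1 h2)
      (ih (n - m) (by omega) (X \ Y) (gp.mono s2) (fun a ha b hb => hinj a (s2 ha) b (s2 hb))
        (by omega) (s2.trans hs) h3 h4)
      hY.1 s2 (hY.disj gp)
    rw [Nat.add_sub_cancel' hmn.le] at this
    exact hneg this
  have hkX : k ≤ X.card := by rw [hX]; exact Nat.le_mul_of_pos_right k (by omega)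
  have hbad : ∀ Y, IsHalf x y X Y → Y.card = k → (Y ∩ A).card = 0 ∨ (Y ∩ B).card = 0 := by
    intro Y hY hc
    by_contra! hcon
    obtain ⟨e1, e2⟩ := compl_counts (R := B) hY.1
    obtain ⟨-, e3⟩ := compl_counts (R := A) hY.1
    have e0 := split_card hd (hY.1.trans hs)
    exact hgood 1 le_rfl (by omega) Y hY (by omega) (by omega) (by omega) (by omega) (by omega)
  rcases half_ivt gp B k 1 hkX (fun Y hY hc h => by
    have e0 := split_card hd (hY.1.trans hs)
    have := hbad Y hY hc
    omega) with h | h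
  · exact mono_case hk hn gp hinj hX hd hs (by omega) (by omega) hgood h
  · refine mono_case hk hn gp hinj hX hd.symm (by rwa [Finset.union_comm]) (by omega) (by omega)
      (fun m h1 h2 Y hY hc p1 p2 p3 p4 => hgood m h1 h2 Y hY hc p2 p1 p4 p3) (fun Y hY hc => ?_)
    have := hbad Y hY hc
    have := h Y hY hc
    omega

lemma genpos_gp (X : Finset (EuclideanSpace ℝ (Fin 2))) (hgp : GenPos 2 X)
    (x y : EuclideanSpace ℝ (Fin 2) →ₗ[ℝ] ℝ) (ε : ℝ) (hx : ∀ p, x p = p 0)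
    (hy : ∀ p, y p = p 1 + ε * p 0) : GP x y X := by
  intro a ha b hb c hc hab hac hbc α β γ h0 fa fb fc
  have hind := hgp {a, b, c} (by
    intro p hp
    simp only [Finset.mem_insert, Finset.mem_singleton] at hp
    rcases hp with rfl | rfl | rfl <;> assumption) (Finset.card_le_three)
  let g : Fin 3 → ({a, b, c} : Finset (EuclideanSpace ℝ (Fin 2))) :=
    ![⟨a, by simp⟩, ⟨b, by simp⟩, ⟨c, by simp⟩]
  have hg : Function.Injective g := by
    intro i j hij
    have := congrArg Subtype.val hij
    fin_cases i <;> fin_cases j <;> simp_all [g]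
  have h3 := hind.comp_embedding ⟨g, hg⟩
  rw [affineIndependent_iff] at h3
  simp only [hx, hy] at fa fb fc
  set s := α + β * ε with hs
  have fa' : s * a 0 + β * a 1 = γ := by rw [hs]; linarith
  have fb' : s * b 0 + β * b 1 = γ := by rw [hs]; linarith
  have fc' : s * c 0 + β * c 1 = γ := by rw [hs]; linarith
  have hN : 0 < s ^ 2 + β ^ 2 := by
    by_cases hβ : β = 0
    · have : s ≠ 0 := by
        rw [hs, hβ]
        simpa [hβ] using h0
      positivity
    · positivity
  set ta := -β * a 0 + s * a 1 with hta
  set tb := -β * b 0 + s * b 1 with htb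
  set tc := -β * c 0 + s * c 1 with htc
  have r0 : ∀ p : EuclideanSpace ℝ (Fin 2), (s ^ 2 + β ^ 2) * p 0
      = s * (s * p 0 + β * p 1) - β * (-β * p 0 + s * p 1) := fun p => by ring
  have r1 : ∀ p : EuclideanSpace ℝ (Fin 2), (s ^ 2 + β ^ 2) * p 1
      = β * (s * p 0 + β * p 1) + s * (-β * p 0 + s * p 1) := fun p => by ring
  have key := h3 Finset.univ ![tb - tc, tc - ta, ta - tb]
    (by simp [Fin.sum_univ_three])
    (by
      simp only [Fin.sum_univ_three, Function.comp, Function.Embedding.coeFn_mk, g]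
      ext i
      fin_cases i
      · simp
        have : (s ^ 2 + β ^ 2) * ((tb - tc) * a 0 + (tc - ta) * b 0 + (ta - tb) * c 0) = 0 := by
          have e : (s ^ 2 + β ^ 2) * ((tb - tc) * a 0 + (tc - ta) * b 0 + (ta - tb) * c 0)
            = (tb - tc) * ((s ^ 2 + β ^ 2) * a 0) + (tc - ta) * ((s ^ 2 + β ^ 2) * b 0)
              + (ta - tb) * ((s ^ 2 + β ^ 2) * c 0) := by ring
          rw [e, r0 a, r0 b, r0 c, fa', fb', fc', ← hta, ← htb, ← htc]
          ring
        exact (mul_eq_zero.1 this).resolve_left hN.ne'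
      · simp
        have : (s ^ 2 + β ^ 2) * ((tb - tc) * a 1 + (tc - ta) * b 1 + (ta - tb) * c 1) = 0 := by
          have e : (s ^ 2 + β ^ 2) * ((tb - tc) * a 1 + (tc - ta) * b 1 + (ta - tb) * c 1)
            = (tb - tc) * ((s ^ 2 + β ^ 2) * a 1) + (tc - ta) * ((s ^ 2 + β ^ 2) * b 1)
              + (ta - tb) * ((s ^ 2 + β ^ 2) * c 1) := by ring
          rw [e, r1 a, r1 b, r1 c, fa', fb', fc', ← hta, ← htb, ← htc]
          ring
        exact (mul_eq_zero.1 this).resolve_left hN.ne')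
  have k2 := key 2 (Finset.mem_univ _)
  have k2' : ta - tb = 0 := by simpa using k2
  apply hab
  ext i
  fin_cases i
  · have := r0 a
    have := r0 b
    have e : (s ^ 2 + β ^ 2) * a 0 = (s ^ 2 + β ^ 2) * b 0 := by
      rw [r0 a, r0 b, fa', fb', ← hta, ← htb]
      linear_combination (-β) * k2'
    exact mul_left_cancel₀ hN.ne' e
  · have e : (s ^ 2 + β ^ 2) * a 1 = (s ^ 2 + β ^ 2) * b 1 := by
      rw [r1 a, r1 b, fa', fb', ← hta, ← htb]
      linear_combination s * k2'
    exact mul_left_cancel₀ hN.ne' e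

lemma exists_eps (X : Finset (EuclideanSpace ℝ (Fin 2))) :
    ∃ ε : ℝ, ∀ a ∈ X, ∀ b ∈ X, a 1 + ε * a 0 = b 1 + ε * b 0 → a = b := by
  obtain ⟨ε, hε⟩ := Infinite.exists_notMem_finset
    ((X ×ˢ X).image (fun p => (p.2 1 - p.1 1) / (p.1 0 - p.2 0)))
  refine ⟨ε, fun a ha b hb h => ?_⟩
  by_cases h0 : a 0 = b 0
  · have h1 : a 1 = b 1 := by rw [h0] at h; linarith
    ext i
    fin_cases i
    · exact h0
    · exact h1
  · exfalso
    apply hε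
    refine Finset.mem_image.2 ⟨(a, b), Finset.mem_product.2 ⟨ha, hb⟩, ?_⟩
    have : a 0 - b 0 ≠ 0 := sub_ne_zero.2 h0
    simp only
    rw [div_eq_iff this]
    linarith

end NEP

theorem near_equipartition_two_colors_plane
    (k n : ℕ) (hk : 2 ≤ k) (hn : 1 ≤ n)
    (A B X : Finset (EuclideanSpace ℝ (Fin 2)))
    (hAB : Disjoint A B) (hX : X = A ∪ B)
    (hcard : X.card = k * n)
    (hA : n ≤ A.card) (hB : n ≤ B.card)
    (hgp : GenPos 2 X) :
    ∃ Y : Fin n → Finset (EuclideanSpace ℝ (Fin 2)),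
      (∀ i, Y i ⊆ X) ∧
      (∀ i, (Y i).card = k) ∧
      (∀ i, ((Y i) ∩ A).Nonempty ∧ ((Y i) ∩ B).Nonempty) ∧
      (∀ i, (X : Set (EuclideanSpace ℝ (Fin 2))) ∩ convexHull ℝ ((Y i : Set (EuclideanSpace ℝ (Fin 2))))
          = (Y i : Set (EuclideanSpace ℝ (Fin 2)))) ∧
      (∀ i j, i ≠ j →
        Disjoint (convexHull ℝ ((Y i : Set (EuclideanSpace ℝ (Fin 2)))))
          (convexHull ℝ ((Y j : Set (EuclideanSpace ℝ (Fin 2)))))) := by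
  obtain ⟨ε, hε⟩ := NEP.exists_eps X
  let x : EuclideanSpace ℝ (Fin 2) →ₗ[ℝ] ℝ := (EuclideanSpace.proj (𝕜 := ℝ) (0 : Fin 2)).toLinearMap
  let y : EuclideanSpace ℝ (Fin 2) →ₗ[ℝ] ℝ :=
    (EuclideanSpace.proj (𝕜 := ℝ) (1 : Fin 2)).toLinearMap + ε • x
  have hx : ∀ p, x p = p 0 := fun p => rfl
  have hy : ∀ p, y p = p 1 + ε * p 0 := fun p => rfl
  have gp := NEP.genpos_gp X hgp x y ε hx hy
  have hXA : X ∩ A = A := Finset.inter_eq_right.2 (hX ▸ Finset.subset_union_left)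
  have hXB : X ∩ B = B := Finset.inter_eq_right.2 (hX ▸ Finset.subset_union_right)
  obtain ⟨F, Fc, Fp, Fd⟩ := NEP.two_thm A B hAB k hk n X gp
    (fun a ha b hb h => hε a ha b hb (by rw [← hy, ← hy]; exact h)) hcard hX.subset
    (by rw [hXA]; exact hA) (by rw [hXB]; exact hB)
  let e := (Finset.equivFinOfCardEq Fc).symm
  have hdis : ∀ i j, i ≠ j →
      Disjoint (convexHull ℝ (((e i).1 : Finset _) : Set (EuclideanSpace ℝ (Fin 2))))
        (convexHull ℝ (((e j).1 : Finset _) : Set (EuclideanSpace ℝ (Fin 2)))) := fun i j hij =>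
    Fd _ (e i).2 _ (e j).2 (fun h => hij (e.injective (Subtype.ext h)))
  have hunion : Finset.univ.biUnion (fun i => (e i).1) = X := by
    refine Finset.eq_of_subset_of_card_le (Finset.biUnion_subset.2 fun i _ => (Fp _ (e i).2).1) ?_
    rw [Finset.card_biUnion]
    · rw [Finset.sum_congr rfl (fun i _ => (Fp _ (e i).2).2.1), hcard]
      simp [mul_comm]
    · intro i _ j _ hij
      have := (hdis i j hij).mono (subset_convexHull ℝ _) (subset_convexHull ℝ _)
      exact Finset.disjoint_coe.1 this
  refine ⟨fun i => (e i).1, fun i => (Fp _ (e i).2).1, fun i => (Fp _ (e i).2).2.1, fun i => ?_,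
    fun i => ?_, hdis⟩
  · have h := (Fp _ (e i).2).2.2
    exact ⟨Finset.card_pos.1 h.1, Finset.card_pos.1 h.2⟩
  · apply Set.Subset.antisymm
    · rintro p ⟨hpX, hp⟩
      have hpX' : p ∈ Finset.univ.biUnion (fun i => (e i).1) := by
        rw [hunion]; exact hpX
      obtain ⟨j, -, hj⟩ := Finset.mem_biUnion.1 hpX'
      by_cases hij : i = j
      · rw [hij]; exact hj
      · exact absurd (subset_convexHull ℝ _ hj) (Set.disjoint_left.1 (hdis i j hij) hp)
    · intro p hp
      exact ⟨(Fp _ (e i).2).1 hp, subset_convexHull ℝ _ hp⟩
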